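/- arXiv:1801.00039 — 4 statements merged into one kernel-verified Lean document; each statement's English description precedes it below -/
import Mathlib

section
/- Let u, v : ℝ × ℝ → ℂ (functions of (t,x)) be continuously differentiable and satisfy the massive Thirring model i(∂_t u + ∂_x u) + v + |v|²u = 0 and i(∂_t v − ∂_x v) + u + |u|²v = 0 at every point (t,x). Then for every λ ∈ ℂ \ {0} and every (t,x) ∈ ℝ², the zero-curvature equation ∂_t L(t,x;λ) − ∂_x A(t,x;λ) + L(t,x;λ)·A(t,x;λ) − A(t,x;λ)·L(t,x;λ) = 0 holds, where L and A are the 2×2 complex matrices defined in the context. -/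
open Complex Matrix

noncomputable def sigma3 : Matrix (Fin 2) (Fin 2) ℂ := !![1, 0; 0, -1]

/-- off-diagonal matrix [[0, conj w],[w, 0]] -/
noncomputable def offMat (w : ℂ) : Matrix (Fin 2) (Fin 2) ℂ := !![0, starRingEnd ℂ w; w, 0]

/-- the Lax matrix L(t,x;λ) of the massive Thirring model -/
noncomputable def Lmat (u v : ℝ × ℝ → ℂ) (t x : ℝ) (lam : ℂ) : Matrix (Fin 2) (Fin 2) ℂ :=
  (I / 4 * ((‖u (t, x)‖ : ℂ) ^ 2 - (‖v (t, x)‖ : ℂ) ^ 2)) • sigma3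
    - (I * lam / 2) • offMat (v (t, x))
    + (I / (2 * lam)) • offMat (u (t, x))
    + (I / 4 * (lam ^ 2 - (lam ^ 2)⁻¹)) • sigma3

/-- the Lax matrix A(t,x;λ) of the massive Thirring model -/
noncomputable def Amat (u v : ℝ × ℝ → ℂ) (t x : ℝ) (lam : ℂ) : Matrix (Fin 2) (Fin 2) ℂ :=
  (-(I / 4) * ((‖u (t, x)‖ : ℂ) ^ 2 + (‖v (t, x)‖ : ℂ) ^ 2)) • sigma3
    - (I * lam / 2) • offMat (v (t, x))
    - (I / (2 * lam)) • offMat (u (t, x))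
    + (I / 4 * (lam ^ 2 + (lam ^ 2)⁻¹)) • sigma3

lemma hasDerivAt_conj {f : ℝ → ℂ} {f' : ℂ} {t : ℝ} (hf : HasDerivAt f f' t) :
    HasDerivAt (fun s => starRingEnd ℂ (f s)) (starRingEnd ℂ f') t := by
  simpa using hf.star

lemma hasDerivAt_norm_sq {f : ℝ → ℂ} {f' : ℂ} {t : ℝ} (hf : HasDerivAt f f' t) :
    HasDerivAt (fun s => (‖f s‖ : ℂ) ^ 2)
      (f' * starRingEnd ℂ (f t) + f t * starRingEnd ℂ f') t := by
  simp only [← Complex.mul_conj']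
  exact hf.mul (hasDerivAt_conj hf)

lemma hasDerivAt_offMat {f : ℝ → ℂ} {f' : ℂ} {t : ℝ} (hf : HasDerivAt f f' t)
    (i j : Fin 2) : HasDerivAt (fun s => offMat (f s) i j) (offMat f' i j) t := by
  fin_cases i <;> fin_cases j <;>
    simp [offMat, hasDerivAt_const, hf, hasDerivAt_conj hf]

/-- If (u,v) solves the massive Thirring model in laboratory coordinates, then the
zero-curvature equation `∂ₜ L − ∂ₓ A + [L, A] = 0` holds for every λ ≠ 0. -/
theorem mtm_zero_curvature (u v : ℝ × ℝ → ℂ)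
    (hu : ContDiff ℝ 1 u) (hv : ContDiff ℝ 1 v)
    (hmtm1 : ∀ t x : ℝ,
      I * (deriv (fun s => u (s, x)) t + deriv (fun y => u (t, y)) x)
        + v (t, x) + (‖v (t, x)‖ : ℂ) ^ 2 * u (t, x) = 0)
    (hmtm2 : ∀ t x : ℝ,
      I * (deriv (fun s => v (s, x)) t - deriv (fun y => v (t, y)) x)
        + u (t, x) + (‖u (t, x)‖ : ℂ) ^ 2 * v (t, x) = 0) :
    ∀ lam : ℂ, lam ≠ 0 → ∀ t x : ℝ,
      (Matrix.of fun i j => deriv (fun s => Lmat u v s x lam i j) t)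
        - (Matrix.of fun i j => deriv (fun y => Amat u v t y lam i j) x)
        + Lmat u v t x lam * Amat u v t x lam
        - Amat u v t x lam * Lmat u v t x lam = 0 := by
  intro lam hlam t x
  have hu' := hu.differentiable one_ne_zero
  have hv' := hv.differentiable one_ne_zero
  have ht {w : ℝ × ℝ → ℂ} (hw : Differentiable ℝ w) :
      HasDerivAt (fun s => w (s, x)) (deriv (fun s => w (s, x)) t) t :=
    DifferentiableAt.hasDerivAt (by fun_prop)
  have hx {w : ℝ × ℝ → ℂ} (hw : Differentiable ℝ w) :
      HasDerivAt (fun y => w (t, y)) (deriv (fun y => w (t, y)) x) x :=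
    DifferentiableAt.hasDerivAt (by fun_prop)
  have hut := ht hu'
  have hvt := ht hv'
  have hux := hx hu'
  have hvx := hx hv'
  have e1 := hmtm1 t x
  have e2 := hmtm2 t x
  generalize deriv (fun s => u (s, x)) t = ut at *
  generalize deriv (fun s => v (s, x)) t = vt at *
  generalize deriv (fun y => u (t, y)) x = ux at *
  generalize deriv (fun y => v (t, y)) x = vx at *
  have hL (i j : Fin 2) := (((((((hasDerivAt_norm_sq hut).sub (hasDerivAt_norm_sq hvt)).const_mul
    (I / 4)).mul_const (sigma3 i j)).sub ((hasDerivAt_offMat hvt i j).const_mul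
    (I * lam / 2))).add ((hasDerivAt_offMat hut i j).const_mul (I / (2 * lam)))).add_const
    (I / 4 * (lam ^ 2 - (lam ^ 2)⁻¹) * sigma3 i j)).deriv
  have hA (i j : Fin 2) := (((((((hasDerivAt_norm_sq hux).add (hasDerivAt_norm_sq hvx)).const_mul
    (-(I / 4))).mul_const (sigma3 i j)).sub ((hasDerivAt_offMat hvx i j).const_mul
    (I * lam / 2))).sub ((hasDerivAt_offMat hux i j).const_mul (I / (2 * lam)))).add_const
    (I / 4 * (lam ^ 2 + (lam ^ 2)⁻¹) * sigma3 i j)).deriv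
  ext i j
  have hL' : deriv (fun s => Lmat u v s x lam i j) t = _ := hL i j
  have hA' : deriv (fun y => Amat u v t y lam i j) x = _ := hA i j
  simp only [Matrix.add_apply, Matrix.sub_apply, of_apply, hL', hA']
  clear hL hA hL' hA' hut hvt hux hvx
  simp only [Lmat, Amat, ← Complex.mul_conj'] at e1 e2 ⊢
  generalize u (t, x) = U at *
  generalize v (t, x) = V at *
  obtain rfl : ut = I * (V + V * starRingEnd ℂ V * U) - ux := by
    linear_combination (-I) * e1 + (ut + ux) * I_sq
  obtain rfl : vt = I * (U + U * starRingEnd ℂ U * V) + vx := by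
    linear_combination (-I) * e2 + (vt - vx) * I_sq
  fin_cases i <;> fin_cases j <;>
    simp [sigma3, offMat, Matrix.mul_apply, Fin.sum_univ_two] <;> field_simp <;> ring_nf
end

section
/- Let u, v ∈ L¹(ℝ) ∩ L^∞(ℝ) with u differentiable and u' ∈ L¹(ℝ). Then for every real z with 0 < |z| < 1 there exist unique bounded continuous functions m₊(·;z), m₋(·;z), n₊(·;z), n₋(·;z) : ℝ → ℂ² satisfying, for all x ∈ ℝ, the Volterra integral equations m_±(x;z) = e₁ + ∫_{±∞}^{x} diag(1, e^{−(i/2)(z−z⁻¹)(x−y)})·(Q₁(u,v)(y) + z·Q₂(u,v)(y))·m_±(y;z) dy and n_±(x;z) = e₂ + ∫_{±∞}^{x} diag(e^{(i/2)(z−z⁻¹)(x−y)}, 1)·(Q₁(u,v)(y) + z·Q₂(u,v)(y))·n_±(y;z) dy, where e₁ = (1,0)ᵀ and e₂ = (0,1)ᵀ. Moreover, there exists a constant C > 0, depending only on u and v, such that sup_{x∈ℝ} |m_±(x;z)| + sup_{x∈ℝ} |n_±(x;z)| ≤ C for all real z with 0 < |z| < 1. -/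
open Complex Matrix MeasureTheory

noncomputable def Q1 (u v : ℝ → ℂ) (x : ℝ) : Matrix (Fin 2) (Fin 2) ℂ :=
  !![-(I / 4) * ((‖u x‖ : ℂ) ^ 2 + (‖v x‖ : ℂ) ^ 2), (I / 2) * starRingEnd ℂ (u x);
     deriv u x - (I / 2) * u x * (‖v x‖ : ℂ) ^ 2 - (I / 2) * v x,
       (I / 4) * ((‖u x‖ : ℂ) ^ 2 + (‖v x‖ : ℂ) ^ 2)]

noncomputable def Q2 (u v : ℝ → ℂ) (x : ℝ) : Matrix (Fin 2) (Fin 2) ℂ :=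
  (I / 2) • !![u x * starRingEnd ℂ (v x), -starRingEnd ℂ (v x);
               u x + (u x) ^ 2 * starRingEnd ℂ (v x), -(u x * starRingEnd ℂ (v x))]

/-- the oscillatory kernel e^{−(i/2)(z−z⁻¹)(x−y)} -/
noncomputable def Em (z x y : ℝ) : ℂ :=
  Complex.exp (-(I / 2) * ((z : ℂ) - (z : ℂ)⁻¹) * ((x : ℂ) - (y : ℂ)))

def e1 : Fin 2 → ℂ := ![1, 0]
def e2 : Fin 2 → ℂ := ![0, 1]

/-- bounded continuous vector function -/
def BddCont (f : ℝ → Fin 2 → ℂ) : Prop := Continuous f ∧ ∃ M : ℝ, ∀ x : ℝ, ‖f x‖ ≤ M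

/-- the four Volterra integral equations for m₊, m₋, n₊, n₋; the integral
`∫_{+∞}^x` is written as `−∫_{[x,∞)}` and `∫_{−∞}^x` as `∫_{(−∞,x]}`. -/
def IsSol (u v : ℝ → ℂ) (z : ℝ) (mp mm np nm : ℝ → Fin 2 → ℂ) : Prop :=
  BddCont mp ∧ BddCont mm ∧ BddCont np ∧ BddCont nm ∧
  (∀ x : ℝ, mp x = e1 - ∫ y in Set.Ici x,
      (!![1, 0; 0, Em z x y] * (Q1 u v y + (z : ℂ) • Q2 u v y)).mulVec (mp y)) ∧
  (∀ x : ℝ, mm x = e1 + ∫ y in Set.Iic x,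
      (!![1, 0; 0, Em z x y] * (Q1 u v y + (z : ℂ) • Q2 u v y)).mulVec (mm y)) ∧
  (∀ x : ℝ, np x = e2 - ∫ y in Set.Ici x,
      (!![Em z y x, 0; 0, 1] * (Q1 u v y + (z : ℂ) • Q2 u v y)).mulVec (np y)) ∧
  (∀ x : ℝ, nm x = e2 + ∫ y in Set.Iic x,
      (!![Em z y x, 0; 0, 1] * (Q1 u v y + (z : ℂ) • Q2 u v y)).mulVec (nm y))

section Volterra

open Filter Topology Set
open scoped BoundedContinuousFunction

/-- An integrable `k` admits a continuous weight `w`, bounded above and away from zero, for which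
`f ↦ ∫ y in Ici x, k y * f y` is a contraction in the weighted supremum norm. -/
theorem exists_weight_Ici {k : ℝ → ℝ} (hk : Integrable k) :
    ∃ w : ℝ → ℝ, ∃ b B : ℝ, 0 < b ∧ Continuous w ∧ (∀ x, b ≤ w x) ∧ (∀ x, w x ≤ B) ∧
      ∀ x, ∫ y in Ici x, k y * w y ≤ w x / 2 := by
  obtain ⟨g, -, hg, hgc, hgi⟩ :=
    hk.exists_hasCompactSupport_integral_sub_le (ε := 1 / 4) (by norm_num)
  set κ : ℝ → ℝ := fun x => ∫ t in (0 : ℝ)..x, |g t| with hκ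
  have hga : Integrable (fun t => |g t|) := hgi.abs
  have hκd : ∀ x, HasDerivAt κ (|g x|) x := fun x =>
    intervalIntegral.integral_hasDerivAt_right hga.intervalIntegrable
      hgc.abs.stronglyMeasurable.stronglyMeasurableAtFilter hgc.abs.continuousAt
  have hκm : Monotone κ := monotone_of_hasDerivAt_nonneg hκd fun x => abs_nonneg _
  set A := ∫ t, |g t| with hA
  have hκA : ∀ x, |κ x| ≤ A := by
    intro x
    calc |κ x| ≤ ∫ t in Set.uIoc 0 x, ‖|g t|‖ :=
          intervalIntegral.norm_integral_le_integral_norm_uIoc (f := fun t => |g t|)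
      _ = ∫ t in Set.uIoc 0 x, |g t| := by simp
      _ ≤ A := setIntegral_le_integral hga (Eventually.of_forall fun t => abs_nonneg _)
  set w : ℝ → ℝ := fun x => Real.exp (-4 * κ x) with hw
  have hwd : ∀ x, HasDerivAt w (w x * (-4 * |g x|)) x := fun x =>
    ((hκd x).const_mul (-4)).exp
  have hwc : Continuous w := continuous_iff_continuousAt.2 fun x => (hwd x).continuousAt
  have hwanti : Antitone w := fun x y h => Real.exp_le_exp.2 (by linarith [hκm h])
  have hwB : ∀ x, w x ≤ Real.exp (4 * A) := fun x =>
    Real.exp_le_exp.2 (by linarith [(abs_le.1 (hκA x)).1])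
  have hwpos : ∀ x, 0 < w x := fun x => Real.exp_pos _
  have hwlim : Tendsto w atTop (𝓝 (Real.exp (-4 * ∫ t in Ioi (0 : ℝ), |g t|))) :=
    (Real.continuous_exp.tendsto _).comp
      ((intervalIntegral_tendsto_integral_Ioi 0 hga.integrableOn tendsto_id).const_mul (-4))
  have hmul : ∀ {f : ℝ → ℝ}, Integrable f → Integrable fun y => f y * w y := fun hf =>
    hf.mul_bdd (c := Real.exp (4 * A)) hwc.aestronglyMeasurable
      (Eventually.of_forall fun x => by
        rw [Real.norm_of_nonneg (hwpos x).le]; exact hwB x)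
  refine ⟨w, Real.exp (-4 * A), Real.exp (4 * A), Real.exp_pos _, hwc,
    fun x => Real.exp_le_exp.2 (by linarith [(abs_le.1 (hκA x)).2]), hwB, fun x => ?_⟩
  have h1 : ∫ y in Ici x, |g y| * w y ≤ w x / 4 := by
    have h := integral_Ioi_of_hasDerivAt_of_tendsto' (a := x) (fun y _ => hwd y)
      (((hmul hga).const_mul (-4)).congr
        (Eventually.of_forall fun y => by ring)).integrableOn hwlim
    have h' : ∫ y in Ioi x, w y * (-4 * |g y|) = -4 * ∫ y in Ioi x, |g y| * w y := by
      rw [← integral_const_mul]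
      congr 1; ext y; ring
    rw [integral_Ici_eq_integral_Ioi]
    rw [h'] at h
    linarith [Real.exp_pos (-4 * ∫ t in Ioi (0 : ℝ), |g t|)]
  have hd : Integrable fun y => |k y - g y| := (hk.sub hgi).abs
  have h2 : ∫ y in Ici x, |k y - g y| * w y ≤ w x / 4 := by
    calc ∫ y in Ici x, |k y - g y| * w y ≤ ∫ y in Ici x, |k y - g y| * w x :=
          setIntegral_mono_on (hmul hd).integrableOn (hd.mul_const _).integrableOn
            measurableSet_Ici fun y hy =>
              mul_le_mul_of_nonneg_left (hwanti hy) (abs_nonneg _)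
      _ = (∫ y in Ici x, |k y - g y|) * w x := integral_mul_const _ _
      _ ≤ 1 / 4 * w x := by
          refine mul_le_mul_of_nonneg_right (le_trans ?_ hg) (hwpos x).le
          exact setIntegral_le_integral hd (Eventually.of_forall fun t => abs_nonneg _)
      _ = w x / 4 := by ring
  calc ∫ y in Ici x, k y * w y ≤ ∫ y in Ici x, (|g y| * w y + |k y - g y| * w y) := by
        refine setIntegral_mono (hmul hk).integrableOn
          ((hmul hga).add (hmul hd)).integrableOn fun y => ?_
        have : k y ≤ |g y| + |k y - g y| := by
          linarith [le_abs_self (g y), le_abs_self (k y - g y)]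
        nlinarith [hwpos y]
    _ = (∫ y in Ici x, |g y| * w y) + ∫ y in Ici x, |k y - g y| * w y :=
        integral_add (hmul hga).integrableOn (hmul hd).integrableOn
    _ ≤ w x / 2 := by linarith

/-- The mirror image of `exists_weight_Ici`. -/
theorem exists_weight_Iic {k : ℝ → ℝ} (hk : Integrable k) :
    ∃ w : ℝ → ℝ, ∃ b B : ℝ, 0 < b ∧ Continuous w ∧ (∀ x, b ≤ w x) ∧ (∀ x, w x ≤ B) ∧
      ∀ x, ∫ y in Iic x, k y * w y ≤ w x / 2 := by
  obtain ⟨w, b, B, hb, hwc, hbw, hwB, hw⟩ := exists_weight_Ici hk.comp_neg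
  refine ⟨fun x => w (-x), b, B, hb, hwc.comp continuous_neg, fun x => hbw _, fun x => hwB _,
    fun x => ?_⟩
  have h := integral_comp_neg_Iic x fun y => k (-y) * w y
  simp only [neg_neg] at h
  rw [h, ← integral_Ici_eq_integral_Ioi]
  exact hw (-x)

variable {E : Type*} [NormedAddCommGroup E] [NormedSpace ℝ E]

/-- A linear Volterra kernel on the sets `S x`, dominated by the integrable function `k`, together
with a weight making the integral operator a contraction. -/
structure VolterraData (S : ℝ → Set ℝ) (K : ℝ → ℝ → E →ₗ[ℝ] E) (k w : ℝ → ℝ) (b B : ℝ) :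
    Prop where
  measurableSet : ∀ x, MeasurableSet (S x)
  eventually_mem_iff : ∀ x y, y ≠ x → ∀ᶠ x' in 𝓝 x, (y ∈ S x' ↔ y ∈ S x)
  integrable : Integrable k
  nonneg : ∀ y, 0 ≤ k y
  norm_le : ∀ x y a, ‖K x y a‖ ≤ k y * ‖a‖
  continuous_left : ∀ y a, Continuous fun x => K x y a
  aestronglyMeasurable : ∀ x (f : ℝ → E), Continuous f →
    AEStronglyMeasurable fun y => K x y (f y)
  pos : 0 < b
  continuous_weight : Continuous w
  le_weight : ∀ x, b ≤ w x
  weight_le : ∀ x, w x ≤ B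
  integral_le : ∀ x, ∫ y in S x, k y * w y ≤ w x / 2

namespace VolterraData

variable {S : ℝ → Set ℝ} {K : ℝ → ℝ → E →ₗ[ℝ] E} {k w : ℝ → ℝ} {b B : ℝ}

theorem weight_pos (h : VolterraData S K k w b B) (x : ℝ) : 0 < w x :=
  h.pos.trans_le (h.le_weight x)

theorem integrable_apply (h : VolterraData S K k w b B) {f : ℝ → E} (hf : Continuous f) {M : ℝ}
    (hM : ∀ x, ‖f x‖ ≤ M) (x : ℝ) : Integrable fun y => K x y (f y) :=
  (h.integrable.mul_const M).mono' (h.aestronglyMeasurable x f hf)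
    (Eventually.of_forall fun y => (h.norm_le x y _).trans
      (mul_le_mul_of_nonneg_left (hM y) (h.nonneg y)))

theorem continuous_integral (h : VolterraData S K k w b B) {f : ℝ → E} (hf : Continuous f)
    {M : ℝ} (hM : ∀ x, ‖f x‖ ≤ M) : Continuous fun x => ∫ y in S x, K x y (f y) := by
  simp_rw [← integral_indicator (h.measurableSet _)]
  refine continuous_iff_continuousAt.2 fun x => ?_
  refine continuousAt_of_dominated (bound := fun y => k y * M)
    (Eventually.of_forall fun x' =>
      (h.aestronglyMeasurable x' f hf).indicator (h.measurableSet x'))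
    (Eventually.of_forall fun x' => Eventually.of_forall fun y => ?_)
    (h.integrable.mul_const M) ?_
  · exact (norm_indicator_le_norm_self _ _).trans ((h.norm_le x' y _).trans
      (mul_le_mul_of_nonneg_left (hM y) (h.nonneg y)))
  · filter_upwards [compl_mem_ae_iff.2 (measure_singleton x)] with y hy
    by_cases hyx : y ∈ S x
    · refine (h.continuous_left y (f y)).continuousAt.congr ?_
      filter_upwards [h.eventually_mem_iff x y hy] with x' hx'
      rw [indicator_of_mem (hx'.2 hyx)]
    · refine (continuousAt_const (y := (0 : E))).congr ?_
      filter_upwards [h.eventually_mem_iff x y hy] with x' hx'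
      rw [indicator_of_notMem (mt hx'.1 hyx)]

theorem norm_integral_le (h : VolterraData S K k w b B) {f : ℝ → E} {c : ℝ} (hc : 0 ≤ c)
    (hfc : ∀ x, ‖f x‖ ≤ c * w x) (x : ℝ) : ‖∫ y in S x, K x y (f y)‖ ≤ c / 2 * w x := by
  have hi : Integrable fun y => k y * w y :=
    h.integrable.mul_bdd (c := B) h.continuous_weight.aestronglyMeasurable
      (Eventually.of_forall fun y => by
        rw [Real.norm_of_nonneg (h.weight_pos y).le]; exact h.weight_le y)
  calc ‖∫ y in S x, K x y (f y)‖ ≤ ∫ y in S x, c * (k y * w y) :=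
        norm_integral_le_of_norm_le (hi.const_mul c).integrableOn
          (Eventually.of_forall fun y => (h.norm_le x y _).trans
            ((mul_le_mul_of_nonneg_left (hfc y) (h.nonneg y)).trans_eq (by ring)))
    _ = c * ∫ y in S x, k y * w y := integral_const_mul _ _
    _ ≤ c * (w x / 2) := mul_le_mul_of_nonneg_left (h.integral_le x) hc
    _ = c / 2 * w x := by ring

theorem norm_le_of_eq (h : VolterraData S K k w b B) {f : ℝ → E} {M : ℝ}
    (hM : ∀ x, ‖f x‖ ≤ M) {a : E} (hfe : ∀ x, f x = a + ∫ y in S x, K x y (f y)) (x : ℝ) :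
    ‖f x‖ ≤ 2 * ‖a‖ / b * B := by
  have hb := h.pos
  set s : ℝ := ⨆ x, ‖f x‖ / w x with hs
  have hbdd : BddAbove (range fun x => ‖f x‖ / w x) := by
    refine ⟨M / b, ?_⟩
    rintro _ ⟨y, rfl⟩
    exact div_le_div₀ ((norm_nonneg _).trans (hM y)) (hM y) h.pos (h.le_weight y)
  have hfs : ∀ y, ‖f y‖ ≤ s * w y := fun y =>
    (div_le_iff₀ (h.weight_pos y)).1 (le_ciSup hbdd y)
  have hs0 : 0 ≤ s := Real.iSup_nonneg fun y => div_nonneg (norm_nonneg _) (h.weight_pos y).le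
  have hle : s ≤ ‖a‖ / b + s / 2 := by
    refine ciSup_le fun y => (div_le_iff₀ (h.weight_pos y)).2 ?_
    have ha : ‖a‖ ≤ ‖a‖ / b * w y := by
      rw [div_mul_eq_mul_div, le_div_iff₀ h.pos]
      exact mul_le_mul_of_nonneg_left (h.le_weight y) (norm_nonneg _)
    rw [hfe y, add_mul]
    exact (norm_add_le _ _).trans (add_le_add ha (h.norm_integral_le hs0 hfs y))
  have hs2 : s ≤ 2 * ‖a‖ / b := by
    rw [mul_div_assoc]; linarith
  exact (hfs x).trans (mul_le_mul hs2 (h.weight_le x) (h.weight_pos x).le (by positivity))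

theorem eq_of_eq (h : VolterraData S K k w b B) {f g : ℝ → E} (hf : Continuous f)
    (hg : Continuous g) {M N : ℝ} (hM : ∀ x, ‖f x‖ ≤ M) (hN : ∀ x, ‖g x‖ ≤ N) {a : E}
    (hfe : ∀ x, f x = a + ∫ y in S x, K x y (f y))
    (hge : ∀ x, g x = a + ∫ y in S x, K x y (g y)) : f = g := by
  ext1 x
  have hd : ∀ x, (f - g) x = 0 + ∫ y in S x, K x y ((f - g) y) := by
    intro x
    simp only [Pi.sub_apply, map_sub]
    rw [integral_sub (h.integrable_apply hf hM x).integrableOn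
      (h.integrable_apply hg hN x).integrableOn]
    nth_rewrite 1 [hfe x, hge x]
    abel
  have := h.norm_le_of_eq (M := M + N)
    (fun x => (norm_sub_le _ _).trans (add_le_add (hM x) (hN x))) hd x
  simpa [sub_eq_zero] using this

theorem exists_eq [CompleteSpace E] (h : VolterraData S K k w b B) (a : E) :
    ∃ f : ℝ → E, Continuous f ∧ (∃ M, ∀ x, ‖f x‖ ≤ M) ∧
      ∀ x, f x = a + ∫ y in S x, K x y (f y) := by
  have hB0 : 0 ≤ B := (h.weight_pos 0).le.trans (h.weight_le 0)
  have hwc : ∀ g : ℝ →ᵇ E, Continuous fun y => w y • g y := fun g =>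
    h.continuous_weight.smul g.continuous
  have hwn : ∀ (g : ℝ →ᵇ E) y, ‖w y • g y‖ ≤ ‖g‖ * w y := fun g y => by
    rw [norm_smul, Real.norm_of_nonneg (h.weight_pos y).le, mul_comm]
    exact mul_le_mul_of_nonneg_right (g.norm_coe_le_norm y) (h.weight_pos y).le
  have hwM : ∀ (g : ℝ →ᵇ E) y, ‖w y • g y‖ ≤ ‖g‖ * B := fun g y =>
    (hwn g y).trans (mul_le_mul_of_nonneg_left (h.weight_le y) (norm_nonneg _))
  have hΦn : ∀ (g : ℝ →ᵇ E) x,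
      ‖(w x)⁻¹ • (a + ∫ y in S x, K x y (w y • g y))‖ ≤ b⁻¹ * (‖a‖ + ‖g‖ / 2 * B) := by
    intro g x
    rw [norm_smul, norm_inv, Real.norm_of_nonneg (h.weight_pos x).le]
    refine mul_le_mul (inv_anti₀ h.pos (h.le_weight x)) ((norm_add_le _ _).trans
      (add_le_add_right ((h.norm_integral_le (norm_nonneg g) (hwn g) x).trans
        (mul_le_mul_of_nonneg_left (h.weight_le x) (by positivity))) _)) (norm_nonneg _)
      (inv_nonneg.2 h.pos.le)
  let Φ : (ℝ →ᵇ E) → (ℝ →ᵇ E) := fun g =>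
    BoundedContinuousFunction.ofNormedAddCommGroup
      (fun x => (w x)⁻¹ • (a + ∫ y in S x, K x y (w y • g y)))
      ((h.continuous_weight.inv₀ fun x => (h.weight_pos x).ne').smul
        (continuous_const.add (h.continuous_integral (hwc g) (hwM g)))) _ (hΦn g)
  have hΦ : ContractingWith (1 / 2) Φ := by
    refine ⟨by rw [← NNReal.coe_lt_coe]; norm_num, LipschitzWith.of_dist_le_mul fun f g => ?_⟩
    refine (BoundedContinuousFunction.dist_le (by positivity)).2 fun x => ?_
    have hd : Φ f x - Φ g x = (w x)⁻¹ • ∫ y in S x, K x y (w y • (f - g) y) := by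
      simp only [Φ, BoundedContinuousFunction.coe_ofNormedAddCommGroup,
        BoundedContinuousFunction.coe_sub, Pi.sub_apply, smul_sub, map_sub (K _ _)]
      rw [integral_sub (h.integrable_apply (hwc f) (hwM f) x).integrableOn
        (h.integrable_apply (hwc g) (hwM g) x).integrableOn, ← smul_sub]
      congr 1
      abel
    rw [dist_eq_norm, hd, norm_smul, norm_inv, Real.norm_of_nonneg (h.weight_pos x).le,
      inv_mul_le_iff₀ (h.weight_pos x), dist_eq_norm]
    refine (h.norm_integral_le (norm_nonneg _) (hwn (f - g)) x).trans_eq ?_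
    push_cast
    ring
  have hfix := hΦ.fixedPoint_isFixedPt
  set g := ContractingWith.fixedPoint Φ hΦ
  refine ⟨fun x => w x • g x, hwc g, ⟨_, hwM g⟩, fun x => ?_⟩
  have hx : Φ g x = g x := by rw [hfix]
  calc w x • g x = w x • Φ g x := by rw [hx]
    _ = _ := smul_inv_smul₀ (h.weight_pos x).ne' _

end VolterraData

end Volterra

section Jost

open Filter Topology Set

theorem norm_Em (z x y : ℝ) : ‖Em z x y‖ = 1 := by
  have h : -(I / 2) * ((z : ℂ) - (z : ℂ)⁻¹) * ((x : ℂ) - (y : ℂ)) =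
      ((-(1 / 2) * (z - z⁻¹) * (x - y) : ℝ) : ℂ) * I := by
    push_cast; ring
  rw [Em, h, Complex.norm_exp_ofReal_mul_I]

theorem continuous_Em (z : ℝ) : Continuous fun p : ℝ × ℝ => Em z p.1 p.2 := by
  unfold Em
  fun_prop

/-- The integrable majorant of the potential `Q1 + z • Q2`, uniform in `|z| < 1`. -/
noncomputable def jostBound (u v : ℝ → ℂ) (y : ℝ) : ℝ :=
  ∑ i, ∑ j, (‖Q1 u v y i j‖ + ‖Q2 u v y i j‖)

theorem jostBound_nonneg (u v : ℝ → ℂ) (y : ℝ) : 0 ≤ jostBound u v y :=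
  Finset.sum_nonneg fun _ _ => Finset.sum_nonneg fun _ _ => by positivity

theorem integrable_Q {u v : ℝ → ℂ} (hu1 : Integrable u) (hv1 : Integrable v)
    (huB : ∃ M : ℝ, ∀ x : ℝ, ‖u x‖ ≤ M) (hvB : ∃ M : ℝ, ∀ x : ℝ, ‖v x‖ ≤ M)
    (hu'1 : Integrable (deriv u)) (i j : Fin 2) :
    Integrable (fun y => Q1 u v y i j) ∧ Integrable (fun y => Q2 u v y i j) := by
  obtain ⟨M, hM⟩ := huB
  obtain ⟨N, hN⟩ := hvB
  have hcu : Integrable fun y => starRingEnd ℂ (u y) :=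
    (LinearIsometryEquiv.integrable_comp_iff Complex.conjLIE).2 hu1
  have hcv : Integrable fun y => starRingEnd ℂ (v y) :=
    (LinearIsometryEquiv.integrable_comp_iff Complex.conjLIE).2 hv1
  have mulu : ∀ {f : ℝ → ℂ}, Integrable f → Integrable fun y => u y * f y := fun hf =>
    hf.bdd_mul hu1.aestronglyMeasurable (Eventually.of_forall hM)
  have mulv : ∀ {f : ℝ → ℂ}, Integrable f → Integrable fun y => v y * f y := fun hf =>
    hf.bdd_mul hv1.aestronglyMeasurable (Eventually.of_forall hN)
  have huu : Integrable fun y => (‖u y‖ : ℂ) ^ 2 := by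
    simpa only [Complex.mul_conj'] using mulu hcu
  have hvv : Integrable fun y => (‖v y‖ : ℂ) ^ 2 := by
    simpa only [Complex.mul_conj'] using mulv hcv
  have huv := mulu hcv
  fin_cases i <;> fin_cases j <;> constructor
  · simpa [Q1] using (huu.add hvv).const_mul (-(I / 4))
  · simpa [Q2] using huv.const_mul (I / 2)
  · simpa [Q1] using hcu.const_mul (I / 2)
  · simpa [Q2] using hcv.neg.const_mul (I / 2)
  · exact ((hu'1.sub ((mulu hvv).const_mul (I / 2))).sub (hv1.const_mul (I / 2))).congr
      (Eventually.of_forall fun y => by simp [Q1, mul_assoc])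
  · simpa [Q2, pow_two, mul_assoc] using (hu1.add (mulu huv)).const_mul (I / 2)
  · simpa [Q1] using (huu.add hvv).const_mul (I / 4)
  · simpa [Q2] using huv.neg.const_mul (I / 2)

theorem norm_mulVec_le_sum (A : Matrix (Fin 2) (Fin 2) ℂ) (a : Fin 2 → ℂ) :
    ‖A.mulVec a‖ ≤ (∑ i, ∑ j, ‖A i j‖) * ‖a‖ := by
  refine (pi_norm_le_iff_of_nonneg (by positivity)).2 fun i => ?_
  calc ‖A.mulVec a i‖ ≤ ∑ j, ‖A i j * a j‖ := norm_sum_le Finset.univ fun j => A i j * a j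
    _ ≤ ∑ j, ‖A i j‖ * ‖a‖ := Finset.sum_le_sum fun j _ => by
        rw [norm_mul]
        exact mul_le_mul_of_nonneg_left (norm_le_pi_norm a j) (norm_nonneg _)
    _ = (∑ j, ‖A i j‖) * ‖a‖ := (Finset.sum_mul _ _ _).symm
    _ ≤ _ := mul_le_mul_of_nonneg_right
        (Finset.single_le_sum (f := fun i => ∑ j, ‖A i j‖)
          (fun i _ => by positivity) (Finset.mem_univ i)) (norm_nonneg _)

/-- The Volterra kernel with row factors `p`, `q` and overall sign `s`. -/
noncomputable def jostKernel (u v : ℝ → ℂ) (z : ℝ) (s : ℂ) (p q : ℝ → ℝ → ℂ) (x y : ℝ) :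
    (Fin 2 → ℂ) →ₗ[ℝ] (Fin 2 → ℂ) :=
  ((s • (!![p x y, 0; 0, q x y] * (Q1 u v y + (z : ℂ) • Q2 u v y))).mulVecLin).restrictScalars ℝ

theorem jostKernel_apply (u v : ℝ → ℂ) (z : ℝ) (s : ℂ) (p q : ℝ → ℝ → ℂ) (x y : ℝ)
    (a : Fin 2 → ℂ) : jostKernel u v z s p q x y a =
      s • (!![p x y, 0; 0, q x y] * (Q1 u v y + (z : ℂ) • Q2 u v y)).mulVec a := by
  simp [jostKernel]

theorem jostKernel_apply_apply (u v : ℝ → ℂ) (z : ℝ) (s : ℂ) (p q : ℝ → ℝ → ℂ) (x y : ℝ)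
    (a : Fin 2 → ℂ) (i : Fin 2) : jostKernel u v z s p q x y a i =
      s * (![p x y, q x y] i * ∑ j, (Q1 u v y i j + (z : ℂ) * Q2 u v y i j) * a j) := by
  have h : ∀ (α β : ℂ) (c : Fin 2 → ℂ), !![α, 0; 0, β].mulVec c i = ![α, β] i * c i := by
    intro α β c
    fin_cases i <;> simp [Matrix.vecHead, Matrix.vecTail]
  rw [jostKernel_apply, Pi.smul_apply, ← Matrix.mulVec_mulVec, h]
  simp only [Matrix.mulVec, dotProduct, Matrix.add_apply, Matrix.smul_apply, smul_eq_mul]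

theorem norm_jostKernel_le (u v : ℝ → ℂ) {z : ℝ} (hz : |z| < 1) {s : ℂ} (hs : ‖s‖ = 1)
    {p q : ℝ → ℝ → ℂ} (hp : ∀ x y, ‖p x y‖ = 1) (hq : ∀ x y, ‖q x y‖ = 1) (x y : ℝ)
    (a : Fin 2 → ℂ) : ‖jostKernel u v z s p q x y a‖ ≤ jostBound u v y * ‖a‖ := by
  refine (pi_norm_le_iff_of_nonneg
    (mul_nonneg (jostBound_nonneg u v y) (norm_nonneg _))).2 fun i => ?_
  have hd : ‖(![p x y, q x y] : Fin 2 → ℂ) i‖ = 1 := by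
    fin_cases i
    exacts [hp x y, hq x y]
  rw [jostKernel_apply_apply, norm_mul, norm_mul, hs, hd, one_mul, one_mul]
  have hm := (norm_le_pi_norm ((Q1 u v y + (z : ℂ) • Q2 u v y).mulVec a) i).trans
    (norm_mulVec_le_sum _ a)
  simp only [Matrix.mulVec, dotProduct, Matrix.add_apply, Matrix.smul_apply, smul_eq_mul] at hm
  refine hm.trans (mul_le_mul_of_nonneg_right ?_ (norm_nonneg _))
  refine Finset.sum_le_sum fun i _ => Finset.sum_le_sum fun j _ => ?_
  refine (norm_add_le _ _).trans (add_le_add_right ?_ _)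
  rw [norm_mul, Complex.norm_real]
  exact mul_le_of_le_one_left (norm_nonneg _) hz.le

theorem volterraData_jostKernel {u v : ℝ → ℂ}
    (hQ : ∀ i j, Integrable (fun y => Q1 u v y i j) ∧ Integrable (fun y => Q2 u v y i j))
    {S : ℝ → Set ℝ} (hSm : ∀ x, MeasurableSet (S x))
    (hS : ∀ x y, y ≠ x → ∀ᶠ x' in 𝓝 x, (y ∈ S x' ↔ y ∈ S x))
    {w : ℝ → ℝ} {b B : ℝ} (hb : 0 < b) (hwc : Continuous w) (hbw : ∀ x, b ≤ w x)
    (hwB : ∀ x, w x ≤ B) (hw : ∀ x, ∫ y in S x, jostBound u v y * w y ≤ w x / 2)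
    {z : ℝ} (hz : |z| < 1) {s : ℂ} (hs : ‖s‖ = 1) {p q : ℝ → ℝ → ℂ}
    (hp : ∀ x y, ‖p x y‖ = 1) (hq : ∀ x y, ‖q x y‖ = 1)
    (hpc : Continuous fun r : ℝ × ℝ => p r.1 r.2) (hqc : Continuous fun r : ℝ × ℝ => q r.1 r.2) :
    VolterraData S (jostKernel u v z s p q) (jostBound u v) w b B where
  measurableSet := hSm
  eventually_mem_iff := hS
  integrable := integrable_finsetSum _ fun i _ => integrable_finsetSum _ fun j _ =>
    (hQ i j).1.norm.add (hQ i j).2.norm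
  nonneg := jostBound_nonneg u v
  norm_le := norm_jostKernel_le u v hz hs hp hq
  continuous_left y a := by
    refine continuous_pi fun i => ?_
    simp only [jostKernel_apply_apply]
    have hd : Continuous fun x => (![p x y, q x y] : Fin 2 → ℂ) i := by
      fin_cases i
      exacts [hpc.comp (continuous_id.prodMk continuous_const),
        hqc.comp (continuous_id.prodMk continuous_const)]
    fun_prop
  aestronglyMeasurable x f hf := by
    refine (aemeasurable_pi_lambda _ fun i => ?_).aestronglyMeasurable
    simp only [jostKernel_apply_apply]
    have hd : Continuous fun y => (![p x y, q x y] : Fin 2 → ℂ) i := by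
      fin_cases i
      exacts [hpc.comp (continuous_const.prodMk continuous_id),
        hqc.comp (continuous_const.prodMk continuous_id)]
    refine (hd.aemeasurable.mul (Finset.aemeasurable_fun_sum _ fun j _ => ?_)).const_mul s
    exact ((hQ i j).1.aemeasurable.add ((hQ i j).2.aemeasurable.const_mul _)).mul
      ((continuous_apply j).comp hf).aemeasurable
  pos := hb
  continuous_weight := hwc
  le_weight := hbw
  weight_le := hwB
  integral_le := hw

theorem eventually_mem_Ici_iff (x y : ℝ) (h : y ≠ x) :
    ∀ᶠ x' in 𝓝 x, (y ∈ Ici x' ↔ y ∈ Ici x) := by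
  rcases h.lt_or_gt with h | h
  · filter_upwards [lt_mem_nhds h] with x' hx'
    simp [hx'.not_ge, h.not_ge]
  · filter_upwards [gt_mem_nhds h] with x' hx'
    simp [le_of_lt hx', h.le]

theorem eventually_mem_Iic_iff (x y : ℝ) (h : y ≠ x) :
    ∀ᶠ x' in 𝓝 x, (y ∈ Iic x' ↔ y ∈ Iic x) := by
  rcases h.lt_or_gt with h | h
  · filter_upwards [lt_mem_nhds h] with x' hx'
    simp [le_of_lt hx', h.le]
  · filter_upwards [gt_mem_nhds h] with x' hx'
    simp [hx'.not_ge, h.not_ge]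

theorem norm_e1_le : ‖e1‖ ≤ 1 :=
  (pi_norm_le_iff_of_nonneg zero_le_one).2 fun i => by fin_cases i <;> simp [e1]

theorem norm_e2_le : ‖e2‖ ≤ 1 :=
  (pi_norm_le_iff_of_nonneg zero_le_one).2 fun i => by fin_cases i <;> simp [e2]

theorem isSol_iff (u v : ℝ → ℂ) (z : ℝ) (mp mm np nm : ℝ → Fin 2 → ℂ) :
    IsSol u v z mp mm np nm ↔
      BddCont mp ∧ BddCont mm ∧ BddCont np ∧ BddCont nm ∧
      (∀ x, mp x = e1 + ∫ y in Ici x,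
        jostKernel u v z (-1) (fun _ _ => 1) (Em z) x y (mp y)) ∧
      (∀ x, mm x = e1 + ∫ y in Iic x,
        jostKernel u v z 1 (fun _ _ => 1) (Em z) x y (mm y)) ∧
      (∀ x, np x = e2 + ∫ y in Ici x,
        jostKernel u v z (-1) (fun x y => Em z y x) (fun _ _ => 1) x y (np y)) ∧
      (∀ x, nm x = e2 + ∫ y in Iic x,
        jostKernel u v z 1 (fun x y => Em z y x) (fun _ _ => 1) x y (nm y)) := by
  simp only [IsSol, jostKernel_apply, neg_smul, one_smul, integral_neg, sub_eq_add_neg]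

end Jost

/-- Existence, uniqueness and uniform boundedness of the transformed Jost functions
for 0 < |z| < 1. -/
theorem jost_existence_small_z (u v : ℝ → ℂ)
    (hu1 : Integrable u) (hv1 : Integrable v)
    (huB : ∃ M : ℝ, ∀ x : ℝ, ‖u x‖ ≤ M) (hvB : ∃ M : ℝ, ∀ x : ℝ, ‖v x‖ ≤ M)
    (hud : Differentiable ℝ u) (hu'1 : Integrable (deriv u)) :
    (∀ z : ℝ, 0 < |z| → |z| < 1 →
      ∃! F : (ℝ → Fin 2 → ℂ) × (ℝ → Fin 2 → ℂ) × (ℝ → Fin 2 → ℂ) × (ℝ → Fin 2 → ℂ),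
        IsSol u v z F.1 F.2.1 F.2.2.1 F.2.2.2) ∧
    (∃ C : ℝ, 0 < C ∧ ∀ z : ℝ, 0 < |z| → |z| < 1 →
      ∀ mp mm np nm : ℝ → Fin 2 → ℂ, IsSol u v z mp mm np nm →
        ∀ x y : ℝ, ‖mp x‖ + ‖np y‖ ≤ C ∧ ‖mm x‖ + ‖nm y‖ ≤ C) := by
  have hQ := integrable_Q hu1 hv1 huB hvB hu'1
  have hk : Integrable (jostBound u v) :=
    integrable_finsetSum _ fun i _ => integrable_finsetSum _ fun j _ =>
      (hQ i j).1.norm.add (hQ i j).2.norm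
  obtain ⟨w, b, B, hb, hwc, hbw, hwB, hw⟩ := exists_weight_Ici hk
  obtain ⟨w', b', B', hb', hwc', hbw', hwB', hw'⟩ := exists_weight_Iic hk
  have hB : 0 ≤ B := hb.le.trans ((hbw 0).trans (hwB 0))
  have hB' : 0 ≤ B' := hb'.le.trans ((hbw' 0).trans (hwB' 0))
  have hEmc : ∀ z, Continuous fun r : ℝ × ℝ => Em z r.2 r.1 := fun z =>
    (continuous_Em z).comp continuous_swap
  have Vmp := fun (z : ℝ) (hz : |z| < 1) =>
    volterraData_jostKernel hQ (fun _ => measurableSet_Ici) eventually_mem_Ici_iff hb hwc hbw hwB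
      hw hz (s := -1) (by simp) (p := fun _ _ => 1) (q := Em z) (by simp) (norm_Em z)
      continuous_const (continuous_Em z)
  have Vmm := fun (z : ℝ) (hz : |z| < 1) =>
    volterraData_jostKernel hQ (fun _ => measurableSet_Iic) eventually_mem_Iic_iff hb' hwc' hbw'
      hwB' hw' hz (s := 1) (by simp) (p := fun _ _ => 1) (q := Em z) (by simp) (norm_Em z)
      continuous_const (continuous_Em z)
  have Vnp := fun (z : ℝ) (hz : |z| < 1) =>
    volterraData_jostKernel hQ (fun _ => measurableSet_Ici) eventually_mem_Ici_iff hb hwc hbw hwB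
      hw hz (s := -1) (by simp) (p := fun x y => Em z y x) (q := fun _ _ => 1)
      (fun x y => norm_Em z y x) (by simp) (hEmc z) continuous_const
  have Vnm := fun (z : ℝ) (hz : |z| < 1) =>
    volterraData_jostKernel hQ (fun _ => measurableSet_Iic) eventually_mem_Iic_iff hb' hwc' hbw'
      hwB' hw' hz (s := 1) (by simp) (p := fun x y => Em z y x) (q := fun _ _ => 1)
      (fun x y => norm_Em z y x) (by simp) (hEmc z) continuous_const
  refine ⟨fun z _ hz => ?_, ?_⟩
  · obtain ⟨mp, hmpc, hmpb, hmp⟩ := (Vmp z hz).exists_eq e1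
    obtain ⟨mm, hmmc, hmmb, hmm⟩ := (Vmm z hz).exists_eq e1
    obtain ⟨np, hnpc, hnpb, hnp⟩ := (Vnp z hz).exists_eq e2
    obtain ⟨nm, hnmc, hnmb, hnm⟩ := (Vnm z hz).exists_eq e2
    refine ⟨(mp, mm, np, nm), (isSol_iff u v z mp mm np nm).2
      ⟨⟨hmpc, hmpb⟩, ⟨hmmc, hmmb⟩, ⟨hnpc, hnpb⟩, ⟨hnmc, hnmb⟩, hmp, hmm, hnp, hnm⟩, ?_⟩
    rintro ⟨mp', mm', np', nm'⟩ h
    obtain ⟨⟨c1, M1, b1⟩, ⟨c2, M2, b2⟩, ⟨c3, M3, b3⟩, ⟨c4, M4, b4⟩, q1, q2, q3, q4⟩ :=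
      (isSol_iff u v z mp' mm' np' nm').1 h
    obtain ⟨N1, d1⟩ := hmpb
    obtain ⟨N2, d2⟩ := hmmb
    obtain ⟨N3, d3⟩ := hnpb
    obtain ⟨N4, d4⟩ := hnmb
    rw [(Vmp z hz).eq_of_eq c1 hmpc b1 d1 q1 hmp, (Vmm z hz).eq_of_eq c2 hmmc b2 d2 q2 hmm,
      (Vnp z hz).eq_of_eq c3 hnpc b3 d3 q3 hnp, (Vnm z hz).eq_of_eq c4 hnmc b4 d4 q4 hnm]
  · have key : ∀ {b B t : ℝ}, 0 < b → 0 ≤ B → t ≤ 1 → 2 * t / b * B ≤ 2 / b * B :=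
      fun hb hB ht => by
        gcongr
        linarith
    have hD : 0 ≤ 2 / b * B := by positivity
    have hD' : 0 ≤ 2 / b' * B' := by positivity
    refine ⟨2 * (2 / b * B) + 2 * (2 / b' * B') + 1, by positivity, ?_⟩
    intro z _ hz mp mm np nm h x y
    obtain ⟨⟨-, M1, b1⟩, ⟨-, M2, b2⟩, ⟨-, M3, b3⟩, ⟨-, M4, b4⟩, q1, q2, q3, q4⟩ :=
      (isSol_iff u v z mp mm np nm).1 h
    have r1 := ((Vmp z hz).norm_le_of_eq b1 q1 x).trans (key hb hB norm_e1_le)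
    have r2 := ((Vmm z hz).norm_le_of_eq b2 q2 x).trans (key hb' hB' norm_e1_le)
    have r3 := ((Vnp z hz).norm_le_of_eq b3 q3 y).trans (key hb hB norm_e2_le)
    have r4 := ((Vnm z hz).norm_le_of_eq b4 q4 y).trans (key hb' hB' norm_e2_le)
    constructor <;> linarith
end

section
/- Let u, v ∈ L¹(ℝ) ∩ L^∞(ℝ) with u differentiable and u' ∈ L¹(ℝ). For each real z with 0 < |z| < 1 let m_±(·;z), n_±(·;z) : ℝ → ℂ² be bounded continuous solutions of the Volterra integral equations m_±(x;z) = e₁ + ∫_{±∞}^{x} diag(1, e^{−(i/2)(z−z⁻¹)(x−y)})·(Q₁(u,v)(y) + z·Q₂(u,v)(y))·m_±(y;z) dy and n_±(x;z) = e₂ + ∫_{±∞}^{x} diag(e^{(i/2)(z−z⁻¹)(x−y)}, 1)·(Q₁(u,v)(y) + z·Q₂(u,v)(y))·n_±(y;z) dy. Then for every fixed x ∈ ℝ, m_±(x;z) → m_±^∞(x)·e₁ and n_±(x;z) → n_±^∞(x)·e₂ as z → 0 with z real and z ≠ 0, where m_±^∞(x) = exp(−(i/4)∫_{±∞}^{x}(|u(y)|²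 + |v(y)|²)dy) and n_±^∞(x) = exp((i/4)∫_{±∞}^{x}(|u(y)|² + |v(y)|²)dy). -/
open Complex Matrix MeasureTheory Filter Topology

/-- `Jp u v x = ∫_x^{+∞}(|u|²+|v|²)dy`, `Jm u v x = ∫_{−∞}^x(|u|²+|v|²)dy` -/
noncomputable def Jp (u v : ℝ → ℂ) (x : ℝ) : ℝ := ∫ y in Set.Ici x, (‖u y‖ ^ 2 + ‖v y‖ ^ 2)
noncomputable def Jm (u v : ℝ → ℂ) (x : ℝ) : ℝ := ∫ y in Set.Iic x, (‖u y‖ ^ 2 + ‖v y‖ ^ 2)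

section IicPrimitive

variable {E : Type*} [NormedAddCommGroup E] [NormedSpace ℝ E]

lemma setIntegral_Iic_eq_add_intervalIntegral {h : ℝ → E} (hh : Integrable h) (c x : ℝ) :
    ∫ y in Set.Iic x, h y = (∫ y in Set.Iic c, h y) + ∫ y in c..x, h y := by
  rw [← intervalIntegral.integral_Iic_sub_Iic hh.integrableOn hh.integrableOn]
  abel

lemma continuous_setIntegral_Iic {h : ℝ → E} (hh : Integrable h) :
    Continuous fun x => ∫ y in Set.Iic x, h y := by
  rw [funext (setIntegral_Iic_eq_add_intervalIntegral hh 0)]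
  exact continuous_const.add
    (intervalIntegral.continuous_primitive (fun _ _ => hh.intervalIntegrable) 0)

lemma ae_hasDerivAt_setIntegral_Iic [CompleteSpace E] {h : ℝ → E} (hh : Integrable h) :
    ∀ᵐ x, HasDerivAt (fun x => ∫ y in Set.Iic x, h y) (h x) x := by
  filter_upwards [LocallyIntegrable.ae_hasDerivAt_integral hh.locallyIntegrable] with x hx
  rw [funext (setIntegral_Iic_eq_add_intervalIntegral hh 0)]
  exact (hx 0).const_add _

lemma tendsto_setIntegral_Iic_atBot {h : ℝ → E} (hh : Integrable h) :
    Tendsto (fun x => ∫ y in Set.Iic x, h y) atBot (𝓝 0) := by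
  have h1 := intervalIntegral_tendsto_integral_Iic (0 : ℝ) hh.integrableOn tendsto_id
  have h2 := h1.const_sub (∫ y in Set.Iic (0 : ℝ), h y)
  rw [sub_self] at h2
  refine h2.congr fun x => ?_
  rw [← intervalIntegral.integral_Iic_sub_Iic hh.integrableOn hh.integrableOn]
  simp

lemma norm_setIntegral_Iic_le {h : ℝ → E} (hh : Integrable h) (x : ℝ) :
    ‖∫ y in Set.Iic x, h y‖ ≤ ∫ y, ‖h y‖ :=
  (norm_integral_le_integral_norm _).trans
    (setIntegral_le_integral hh.norm (Eventually.of_forall fun _ => norm_nonneg _))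

lemma dist_setIntegral_Iic_le {h : ℝ → E} {b : ℝ → ℝ} (hh : Integrable h) (hb : Integrable b)
    (hhb : ∀ y, ‖h y‖ ≤ b y) (s t : ℝ) :
    ‖(∫ y in Set.Iic t, h y) - ∫ y in Set.Iic s, h y‖ ≤
      |(∫ y in Set.Iic t, b y) - ∫ y in Set.Iic s, b y| := by
  rw [intervalIntegral.integral_Iic_sub_Iic hh.integrableOn hh.integrableOn,
    intervalIntegral.integral_Iic_sub_Iic hb.integrableOn hb.integrableOn]
  exact intervalIntegral.norm_integral_le_abs_of_norm_le (Eventually.of_forall fun y => hhb y)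
    hb.intervalIntegrable

end IicPrimitive

lemma AbsolutelyContinuousOnInterval.of_dist_le {X Y : Type*} [PseudoMetricSpace X]
    [PseudoMetricSpace Y] {f : ℝ → X} {g : ℝ → Y} {a b K : ℝ}
    (hg : AbsolutelyContinuousOnInterval g a b)
    (hfg : ∀ s t, dist (f s) (f t) ≤ K * dist (g s) (g t)) :
    AbsolutelyContinuousOnInterval f a b := by
  have h := Tendsto.const_mul K hg
  rw [mul_zero] at h
  refine squeeze_zero (fun E => Finset.sum_nonneg fun _ _ => dist_nonneg) (fun E => ?_) h
  rw [Finset.mul_sum]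
  exact Finset.sum_le_sum fun _ _ => hfg _ _

lemma norm_exp_sub_exp_le {R : ℝ} {p q : ℂ} (hp : ‖p‖ ≤ R) (hq : ‖q‖ ≤ R) :
    ‖Complex.exp p - Complex.exp q‖ ≤ Real.exp R * ‖p - q‖ := by
  refine (convex_closedBall (0 : ℂ) R).norm_image_sub_le_of_norm_deriv_le (𝕜 := ℂ)
    (fun x _ => Complex.differentiableAt_exp) (fun x hx => ?_) (by simpa using hq)
    (by simpa using hp)
  rw [Complex.deriv_exp, Complex.norm_exp]
  exact Real.exp_le_exp.2 ((Complex.re_le_norm x).trans (by simpa using hx))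

/-- The exponential of a primitive of an integrable function `a`. -/
noncomputable def expPrim (a : ℝ → ℂ) (x : ℝ) : ℂ := Complex.exp (∫ y in Set.Iic x, a y)

section expPrim

variable {a : ℝ → ℂ}

lemma continuous_expPrim (ha : Integrable a) : Continuous (expPrim a) :=
  Complex.continuous_exp.comp (continuous_setIntegral_Iic ha)

lemma norm_expPrim_le (ha : Integrable a) (x : ℝ) :
    ‖expPrim a x‖ ≤ Real.exp (∫ y, ‖a y‖) := by
  rw [expPrim, Complex.norm_exp]
  exact Real.exp_le_exp.2 ((Complex.re_le_norm _).trans (norm_setIntegral_Iic_le ha x))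

lemma integrable_mul_expPrim (ha : Integrable a) {c : ℝ → ℂ} (hc : Integrable c) :
    Integrable fun y => c y * expPrim a y :=
  hc.mul_bdd (c := Real.exp (∫ y, ‖a y‖)) (continuous_expPrim ha).aestronglyMeasurable
    (Eventually.of_forall (norm_expPrim_le ha))

/-- `expPrim a` solves the scalar Volterra equation with coefficient `a`. -/
lemma setIntegral_Iic_mul_expPrim (ha : Integrable a) (x : ℝ) :
    ∫ y in Set.Iic x, a y * expPrim a y = expPrim a x - 1 := by
  have haF := integrable_mul_expPrim ha ha
  set R := ∫ y, ‖a y‖ with hR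
  set H : ℝ → ℂ := fun t => expPrim a t - ∫ y in Set.Iic t, a y * expPrim a y with hH
  have hdist : ∀ c s t, dist (H s) (H t) ≤
      (2 * Real.exp R) * dist (∫ y in c..s, ‖a y‖) (∫ y in c..t, ‖a y‖) := by
    intro c s t
    have e : dist (∫ y in c..s, ‖a y‖) (∫ y in c..t, ‖a y‖)
        = |(∫ y in Set.Iic s, ‖a y‖) - ∫ y in Set.Iic t, ‖a y‖| := by
      rw [Real.dist_eq, setIntegral_Iic_eq_add_intervalIntegral ha.norm c s,
        setIntegral_Iic_eq_add_intervalIntegral ha.norm c t, add_sub_add_left_eq_sub]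
    have h1 : ‖expPrim a s - expPrim a t‖ ≤ Real.exp R *
        |(∫ y in Set.Iic s, ‖a y‖) - ∫ y in Set.Iic t, ‖a y‖| :=
      (norm_exp_sub_exp_le (norm_setIntegral_Iic_le ha s) (norm_setIntegral_Iic_le ha t)).trans
        (mul_le_mul_of_nonneg_left
          (dist_setIntegral_Iic_le ha ha.norm (fun _ => le_rfl) t s) (Real.exp_pos _).le)
    have h2 := dist_setIntegral_Iic_le haF (ha.norm.const_mul (Real.exp R)) (fun y => by
      rw [norm_mul, mul_comm]
      exact mul_le_mul_of_nonneg_right (norm_expPrim_le ha y) (norm_nonneg _)) t s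
    simp_rw [integral_const_mul] at h2
    rw [← mul_sub, abs_mul, abs_of_pos (Real.exp_pos _)] at h2
    rw [e, dist_eq_norm, hH]
    calc _ = ‖(expPrim a s - expPrim a t) - ((∫ y in Set.Iic s, a y * expPrim a y) -
          ∫ y in Set.Iic t, a y * expPrim a y)‖ := by congr 1; ring
      _ ≤ _ := (norm_sub_le _ _).trans (by linarith)
  have hder : ∀ᵐ t, HasDerivAt H 0 t := by
    filter_upwards [ae_hasDerivAt_setIntegral_Iic ha, ae_hasDerivAt_setIntegral_Iic haF]
      with t h1 h2
    exact (h1.cexp.sub h2).congr_deriv (by rw [expPrim]; ring)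
  have hconst : ∀ s, H s = H x := by
    intro s
    have hac : AbsolutelyContinuousOnInterval H s x :=
      (ha.norm.intervalIntegrable.absolutelyContinuousOnInterval_intervalIntegral
        Set.left_mem_uIcc).of_dist_le (hdist s)
    obtain ⟨C, hC⟩ := hac.const_of_ae_hasDerivAt_zero (hder.mono fun _ h _ => h)
    rw [hC s Set.left_mem_uIcc, hC x Set.right_mem_uIcc]
  have hlim : Tendsto H atBot (𝓝 (Complex.exp 0 - 0)) :=
    ((Complex.continuous_exp.tendsto 0).comp (tendsto_setIntegral_Iic_atBot ha)).sub
      (tendsto_setIntegral_Iic_atBot haF)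
  have := tendsto_nhds_unique (tendsto_const_nhds.congr fun s => (hconst s).symm) hlim
  rw [hH] at this
  simp only [Complex.exp_zero, sub_zero] at this
  rw [← this]; ring

end expPrim

section Gronwall

variable {k : ℝ → ℝ}

lemma setIntegral_Iic_mul_exp (hk : Integrable k) (x : ℝ) :
    ∫ y in Set.Iic x, k y * Real.exp (∫ t in Set.Iic y, k t) =
      Real.exp (∫ t in Set.Iic x, k t) - 1 := by
  have h := setIntegral_Iic_mul_expPrim (a := fun y => (k y : ℂ)) hk.ofReal x
  simp only [expPrim] at h
  simp_rw [integral_complex_ofReal, ← Complex.ofReal_exp, ← Complex.ofReal_mul,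
    integral_complex_ofReal] at h
  exact_mod_cast h

lemma integrable_mul_of_bounded {k φ : ℝ → ℝ} {M : ℝ} (hk : Integrable k) (hφ : Continuous φ)
    (hM : ∀ x, ‖φ x‖ ≤ M) : Integrable fun y => k y * φ y :=
  hk.mul_bdd hφ.aestronglyMeasurable (Eventually.of_forall hM)

/-- Grönwall's inequality on the half-line `(-∞, x]`, for an integrable weight and a constant
source. -/
lemma le_of_le_const_add_setIntegral_Iic (hk : Integrable k) (hk0 : ∀ y, 0 ≤ k y)
    {ψ : ℝ → ℝ} (hψ : Continuous ψ) (hψ0 : ∀ x, 0 ≤ ψ x) {M ρ : ℝ} (hM : ∀ x, ψ x ≤ M)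
    (h : ∀ x, ψ x ≤ ρ + ∫ y in Set.Iic x, k y * ψ y) (x : ℝ) :
    ψ x ≤ 2 * ρ * Real.exp (2 * ∫ y, k y) := by
  have hK0 : ∀ x, 0 ≤ ∫ y in Set.Iic x, 2 * k y := fun x =>
    integral_nonneg fun y => mul_nonneg two_pos.le (hk0 y)
  set w : ℝ → ℝ := fun x => Real.exp (∫ y in Set.Iic x, 2 * k y) with hw
  have hw1 : ∀ x, 1 ≤ w x := fun x => Real.one_le_exp (hK0 x)
  have hw0 : ∀ x, 0 < w x := fun x => Real.exp_pos _
  have hwc : Continuous w := Real.continuous_exp.comp (continuous_setIntegral_Iic (hk.const_mul 2))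
  have hwM : ∀ x, w x ≤ Real.exp (2 * ∫ y, k y) := fun x => by
    rw [hw, ← integral_const_mul]
    exact Real.exp_le_exp.2 (setIntegral_le_integral (hk.const_mul 2)
      (Eventually.of_forall fun y => mul_nonneg two_pos.le (hk0 y)))
  have hbdd : BddAbove (Set.range fun x => ψ x / w x) := by
    refine ⟨M, ?_⟩
    rintro _ ⟨x, rfl⟩
    exact (div_le_self (hψ0 x) (hw1 x)).trans (hM x)
  set N := ⨆ x, ψ x / w x with hN
  have hψN : ∀ x, ψ x ≤ N * w x := fun x => (div_le_iff₀ (hw0 x)).1 (le_ciSup hbdd x)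
  have hN0 : 0 ≤ N := (div_nonneg (hψ0 0) (hw0 0).le).trans (le_ciSup hbdd 0)
  have hint : ∀ x, ∫ y in Set.Iic x, k y * ψ y ≤ N / 2 * (w x - 1) := by
    intro x
    rw [hw, ← setIntegral_Iic_mul_exp (hk.const_mul 2) x, ← integral_const_mul]
    refine setIntegral_mono (integrable_mul_of_bounded (M := M) hk hψ fun x => by
      rw [Real.norm_of_nonneg (hψ0 x)]; exact hM x).integrableOn
      (((integrable_mul_of_bounded (hk.const_mul 2) hwc fun x => by
        rw [Real.norm_of_nonneg (hw0 x).le]; exact hwM x).const_mul _).integrableOn) fun y => ?_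
    have := mul_le_mul_of_nonneg_left (hψN y) (hk0 y)
    simp only [hw] at this ⊢
    linarith
  have hρ : 0 ≤ ρ := by
    by_contra hρ
    have hlim := tendsto_setIntegral_Iic_atBot (integrable_mul_of_bounded (M := M) hk hψ fun x => by
      rw [Real.norm_of_nonneg (hψ0 x)]; exact hM x)
    obtain ⟨x, hx⟩ := (hlim.eventually (gt_mem_nhds (show 0 < -ρ by linarith))).exists
    linarith [h x, hψ0 x]
  have hN2 : N ≤ ρ + N / 2 := by
    refine ciSup_le fun x => (div_le_iff₀ (hw0 x)).2 ?_
    nlinarith [h x, hint x, hw1 x]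
  calc ψ x ≤ N * w x := hψN x
    _ ≤ 2 * ρ * Real.exp (2 * ∫ y, k y) :=
      mul_le_mul (by linarith) (hwM x) (hw0 x).le (by linarith)

/-- Grönwall's inequality on the half-line `(-∞, x]`, for an integrable weight and a bounded
continuous source. -/
lemma le_of_le_add_setIntegral_Iic (hk : Integrable k) (hk0 : ∀ y, 0 ≤ k y)
    {φ r : ℝ → ℝ} (hφ : Continuous φ) (hφ0 : ∀ x, 0 ≤ φ x) {M M' : ℝ} (hM : ∀ x, φ x ≤ M)
    (hr : Continuous r) (hr0 : ∀ x, 0 ≤ r x) (hM' : ∀ x, r x ≤ M')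
    (h : ∀ x, φ x ≤ r x + ∫ y in Set.Iic x, k y * φ y) (x : ℝ) :
    φ x ≤ r x + 2 * (∫ y, k y * r y) * Real.exp (2 * ∫ y, k y) := by
  have hkφ : Integrable fun y => k y * φ y := integrable_mul_of_bounded (M := M) hk hφ fun x => by
    rw [Real.norm_of_nonneg (hφ0 x)]; exact hM x
  have hkr : Integrable fun y => k y * r y := integrable_mul_of_bounded (M := M') hk hr fun x => by
    rw [Real.norm_of_nonneg (hr0 x)]; exact hM' x
  have hψc := continuous_setIntegral_Iic hkφ
  have hψ0 : ∀ x, 0 ≤ ∫ y in Set.Iic x, k y * φ y := fun x =>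
    integral_nonneg fun y => mul_nonneg (hk0 y) (hφ0 y)
  have hψM : ∀ x, ∫ y in Set.Iic x, k y * φ y ≤ ∫ y, k y * φ y := fun x =>
    setIntegral_le_integral hkφ (Eventually.of_forall fun y => mul_nonneg (hk0 y) (hφ0 y))
  have hkψ : Integrable fun y => k y * ∫ t in Set.Iic y, k t * φ t :=
    integrable_mul_of_bounded hk hψc fun x => by
      rw [Real.norm_of_nonneg (hψ0 x)]; exact hψM x
  have key := le_of_le_const_add_setIntegral_Iic hk hk0 hψc hψ0 hψM
    (ρ := ∫ y, k y * r y) (fun x => ?_) x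
  · linarith [h x]
  · calc ∫ y in Set.Iic x, k y * φ y
        ≤ ∫ y in Set.Iic x, (k y * r y + k y * ∫ t in Set.Iic y, k t * φ t) := by
          refine setIntegral_mono hkφ.integrableOn (hkr.add hkψ).integrableOn fun y => ?_
          rw [← mul_add]
          exact mul_le_mul_of_nonneg_left (h y) (hk0 y)
      _ = (∫ y in Set.Iic x, k y * r y) +
            ∫ y in Set.Iic x, k y * ∫ t in Set.Iic y, k t * φ t :=
          integral_add hkr.integrableOn hkψ.integrableOn
      _ ≤ _ := add_le_add (setIntegral_le_integral hkr
          (Eventually.of_forall fun y => mul_nonneg (hk0 y) (hr0 y))) le_rfl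

end Gronwall

/-- The oscillatory kernel `e^{iw(x-y)}`. -/
noncomputable def osc (w x y : ℝ) : ℂ := Complex.exp (I * w * ((x : ℂ) - (y : ℂ)))

section Oscillation

lemma norm_osc (w x y : ℝ) : ‖osc w x y‖ = 1 := by
  rw [osc, show I * w * ((x : ℂ) - (y : ℂ)) = ((w * (x - y) : ℝ) : ℂ) * I by push_cast; ring,
    Complex.norm_exp_ofReal_mul_I]

lemma continuous_osc (w x : ℝ) : Continuous (osc w x) := by
  unfold osc; fun_prop

lemma osc_eq_mul (w x y : ℝ) : osc w x y = osc w x 0 * osc w 0 y := by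
  rw [osc, osc, osc, ← Complex.exp_add]
  congr 1
  push_cast
  ring

lemma integrable_osc_mul {h : ℝ → ℂ} (hh : Integrable h) (w x : ℝ) :
    Integrable fun y => osc w x y * h y :=
  hh.bdd_mul (c := 1) (continuous_osc w x).aestronglyMeasurable
    (Eventually.of_forall fun y => (norm_osc w x y).le)

lemma norm_setIntegral_osc_mul_le {h : ℝ → ℂ} (hh : Integrable h) (w x : ℝ) :
    ‖∫ y in Set.Iic x, osc w x y * h y‖ ≤ ∫ y, ‖h y‖ := by
  refine (norm_setIntegral_Iic_le (integrable_osc_mul hh w x) x).trans_eq ?_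
  simp [norm_osc]

lemma continuous_setIntegral_osc_mul {h : ℝ → ℂ} (hh : Integrable h) (w : ℝ) :
    Continuous fun x => ∫ y in Set.Iic x, osc w x y * h y := by
  have e : (fun x => ∫ y in Set.Iic x, osc w x y * h y) =
      fun x => osc w x 0 * ∫ y in Set.Iic x, osc w 0 y * h y := by
    funext x
    rw [← integral_const_mul]
    congr 1
    funext y
    rw [osc_eq_mul w x y, mul_assoc]
  rw [e]
  refine Continuous.mul (by unfold osc; fun_prop)
    (continuous_setIntegral_Iic (integrable_osc_mul hh w 0))

/-- The Riemann-Lebesgue lemma on the half-line `(-∞, x]`. -/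
lemma tendsto_setIntegral_osc_mul {ι : Type*} {l : Filter ι} {ω : ι → ℝ}
    (hω : Tendsto ω l (cocompact ℝ)) (h : ℝ → ℂ) (x : ℝ) :
    Tendsto (fun z => ∫ y in Set.Iic x, osc (ω z) x y * h y) l (𝓝 0) := by
  have h2π : Tendsto (fun z => ω z * (2 * Real.pi)⁻¹) l (cocompact ℝ) :=
    (Homeomorph.mulRight₀ ((2 * Real.pi)⁻¹)
      (by positivity)).isClosedEmbedding.tendsto_cocompact.comp hω
  have hRL := (Real.tendsto_integral_exp_smul_cocompact ((Set.Iic x).indicator h)).comp h2π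
  rw [tendsto_zero_iff_norm_tendsto_zero] at hRL ⊢
  refine hRL.congr fun z => ?_
  have e : ∀ y, osc (ω z) 0 y = Real.fourierChar (-(y * (ω z * (2 * Real.pi)⁻¹))) := by
    intro y
    rw [Real.fourierChar_apply, osc]
    congr 1
    push_cast
    field_simp
    ring
  have e2 : ∫ y in Set.Iic x, osc (ω z) x y * h y = osc (ω z) x 0 *
      ∫ y, Real.fourierChar (-(y * (ω z * (2 * Real.pi)⁻¹))) • (Set.Iic x).indicator h y := by
    rw [← integral_const_mul, ← integral_indicator measurableSet_Iic]
    congr 1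
    funext y
    by_cases hy : y ∈ Set.Iic x
    · rw [Set.indicator_of_mem hy, Set.indicator_of_mem hy, osc_eq_mul, e, mul_assoc]
      rfl
    · simp [Set.indicator_of_notMem hy]
  rw [e2, norm_mul, norm_osc, one_mul, Function.comp]

end Oscillation

/-- If the diagonal coefficient `A z` of a Volterra system tends to `a` and the phase `ω z` of the
second equation diverges, then the solutions tend to `(expPrim a, 0)`. -/
theorem tendsto_volterra {ι : Type*} {l : Filter ι} [l.IsCountablyGenerated]
    {a c : ℝ → ℂ} {k : ℝ → ℝ} {A B C D f g : ι → ℝ → ℂ} {δ ω : ι → ℝ}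
    (hk : Integrable k) (ha : Integrable a) (hc : Integrable c)
    (hδ : Tendsto δ l (𝓝 0)) (hω : Tendsto ω l (cocompact ℝ))
    (hA : ∀ z, AEStronglyMeasurable (A z)) (hB : ∀ z, AEStronglyMeasurable (B z))
    (hC : ∀ z, AEStronglyMeasurable (C z)) (hD : ∀ z, AEStronglyMeasurable (D z))
    (hsol : ∀ᶠ z in l, 0 ≤ δ z ∧
      (∀ y, ‖A z y‖ ≤ k y) ∧ (∀ y, ‖B z y‖ ≤ k y) ∧ (∀ y, ‖C z y‖ ≤ k y) ∧ (∀ y, ‖D z y‖ ≤ k y) ∧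
      (∀ y, ‖A z y - a y‖ ≤ δ z * k y) ∧ (∀ y, ‖C z y - c y‖ ≤ δ z * k y) ∧
      Continuous (f z) ∧ Continuous (g z) ∧ (∃ M, ∀ x, ‖f z x‖ ≤ M) ∧ (∃ M, ∀ x, ‖g z x‖ ≤ M) ∧
      (∀ x, f z x = 1 + ∫ y in Set.Iic x, (A z y * f z y + B z y * g z y)) ∧
      ∀ x, g z x = ∫ y in Set.Iic x, osc (ω z) x y * (C z y * f z y + D z y * g z y))
    (x : ℝ) :
    Tendsto (fun z => f z x) l (𝓝 (expPrim a x)) ∧ Tendsto (fun z => g z x) l (𝓝 0) := by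
  set F := expPrim a with hF
  set R := Real.exp (∫ y, ‖a y‖) with hR
  have hFc : Continuous F := continuous_expPrim ha
  have hFR : ∀ y, ‖F y‖ ≤ R := norm_expPrim_le ha
  have hcF : Integrable fun y => c y * F y := integrable_mul_expPrim ha hc
  set S : ι → ℝ → ℂ := fun z x => ∫ y in Set.Iic x, osc (ω z) x y * (c y * F y) with hS
  set r : ι → ℝ → ℝ := fun z x => ‖S z x‖ + 2 * (δ z * R * ∫ y, k y) with hr
  have hSc : ∀ z, Continuous (S z) := fun z => continuous_setIntegral_osc_mul hcF _
  have hSb : ∀ z x, ‖S z x‖ ≤ ∫ y, ‖c y * F y‖ := fun z x => norm_setIntegral_osc_mul_le hcF _ x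
  have hrc : ∀ z, Continuous (r z) := fun z => (hSc z).norm.add continuous_const
  have hr_lim : ∀ x, Tendsto (fun z => r z x) l (𝓝 0) := by
    intro x
    have h1 := (tendsto_setIntegral_osc_mul hω (fun y => c y * F y) x).norm
    have h2 := ((hδ.mul_const R).mul_const (∫ y, k y)).const_mul 2
    simpa using h1.add h2
  have hδ1 : ∀ᶠ z in l, δ z ≤ 1 := hδ.eventually (ge_mem_nhds one_pos)
  have hkr_lim : Tendsto (fun z => ∫ y, 2 * k y * r z y) l (𝓝 0) := by
    have := tendsto_integral_filter_of_dominated_convergence (μ := volume) (l := l)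
      (F := fun z y => 2 * k y * r z y) (f := fun _ => 0)
      (fun y => ‖2 * k y‖ * ((∫ y, ‖c y * F y‖) + 2 * (R * |∫ y, k y|)))
      (Eventually.of_forall fun z =>
        (hk.const_mul 2).aestronglyMeasurable.mul (hrc z).aestronglyMeasurable) ?_
      ((hk.const_mul 2).norm.mul_const _)
      (Eventually.of_forall fun y => by simpa using (hr_lim y).const_mul (2 * k y))
    · simpa using this
    · filter_upwards [hδ1, hsol] with z hz1 hz
      refine Eventually.of_forall fun y => ?_
      rw [norm_mul]
      gcongr
      refine (norm_add_le _ _).trans ?_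
      rw [norm_norm]
      refine add_le_add (hSb z y) ?_
      rw [norm_mul, norm_mul, norm_mul, Real.norm_of_nonneg hz.1, Real.norm_of_nonneg two_pos.le,
        Real.norm_of_nonneg (Real.exp_pos _).le, Real.norm_eq_abs]
      have : δ z * R * |∫ y, k y| ≤ 1 * R * |∫ y, k y| := by
        have := Real.exp_pos (∫ y, ‖a y‖)
        gcongr
      linarith
  have key : ∀ᶠ z in l, ‖f z x - F x‖ + ‖g z x‖ ≤
      r z x + 2 * (∫ y, 2 * k y * r z y) * Real.exp (2 * ∫ y, 2 * k y) := by
    filter_upwards [hsol] with z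
      ⟨hδ0, hAk, hBk, hCk, hDk, hAa, hCc, hfc, hgc, ⟨Mf, hMf⟩, ⟨Mg, hMg⟩, hfe, hge⟩
    have hk0 : ∀ y, 0 ≤ k y := fun y => (norm_nonneg _).trans (hAk y)
    have hint : ∀ {P q : ℝ → ℂ} {M : ℝ}, AEStronglyMeasurable P → (∀ y, ‖P y‖ ≤ k y) →
        Continuous q → (∀ y, ‖q y‖ ≤ M) → Integrable fun y => P y * q y :=
      fun hP hPk hq hM => (hk.mono' hP (Eventually.of_forall hPk)).mul_bdd
        hq.aestronglyMeasurable (Eventually.of_forall hM)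
    have hwc : Continuous fun y => f z y - F y := hfc.sub hFc
    have hwM : ∀ y, ‖f z y - F y‖ ≤ Mf + R := fun y =>
      (norm_sub_le _ _).trans (add_le_add (hMf y) (hFR y))
    have hφM : ∀ y, ‖f z y - F y‖ + ‖g z y‖ ≤ Mf + R + Mg := fun y =>
      add_le_add (hwM y) (hMg y)
    have hφc : Continuous fun y => ‖f z y - F y‖ + ‖g z y‖ := hwc.norm.add hgc.norm
    have hkφ : Integrable fun y => k y * (‖f z y - F y‖ + ‖g z y‖) :=
      integrable_mul_of_bounded (M := Mf + R + Mg) hk hφc fun y => by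
        rw [Real.norm_of_nonneg (by positivity)]; exact hφM y
    -- both error terms are dominated in the same way
    have bound : ∀ {P Q p : ℝ → ℂ} (E : ℝ → ℂ) (x : ℝ), (∀ y, ‖P y‖ ≤ k y) → (∀ y, ‖Q y‖ ≤ k y) →
        (∀ y, ‖P y - p y‖ ≤ δ z * k y) → (∀ y, ‖E y‖ = 1) →
        ‖∫ y in Set.Iic x, E y * (P y * (f z y - F y) + Q y * g z y + (P y - p y) * F y)‖ ≤
          (∫ y in Set.Iic x, k y * (‖f z y - F y‖ + ‖g z y‖)) + δ z * R * ∫ y, k y := by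
      intro P Q p E x hP hQ hPp hE
      have hb : Integrable fun y => k y * (‖f z y - F y‖ + ‖g z y‖) + δ z * R * k y :=
        hkφ.add (hk.const_mul _)
      calc _ ≤ ∫ y in Set.Iic x, (k y * (‖f z y - F y‖ + ‖g z y‖) + δ z * R * k y) := by
            refine norm_integral_le_of_norm_le hb.integrableOn (Eventually.of_forall fun y => ?_)
            rw [norm_mul, hE, one_mul]
            refine norm_add₃_le.trans ?_
            rw [norm_mul, norm_mul, norm_mul]
            have h1 := mul_le_mul_of_nonneg_right (hP y) (norm_nonneg (f z y - F y))
            have h2 := mul_le_mul_of_nonneg_right (hQ y) (norm_nonneg (g z y))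
            have h3 := mul_le_mul (hPp y) (hFR y) (norm_nonneg _) (mul_nonneg hδ0 (hk0 y))
            linarith
        _ = (∫ y in Set.Iic x, k y * (‖f z y - F y‖ + ‖g z y‖)) +
            δ z * R * ∫ y in Set.Iic x, k y := by
            rw [integral_add hkφ.integrableOn (hk.const_mul _).integrableOn, integral_const_mul]
        _ ≤ _ := by
            have : ∫ y in Set.Iic x, k y ≤ ∫ y, k y :=
              setIntegral_le_integral hk (Eventually.of_forall hk0)
            have := mul_le_mul_of_nonneg_left this
              (mul_nonneg hδ0 (Real.exp_pos (∫ y, ‖a y‖)).le)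
            linarith
    have hwe : ∀ x, f z x - F x = ∫ y in Set.Iic x,
        1 * (A z y * (f z y - F y) + B z y * g z y + (A z y - a y) * F y) := by
      intro x
      have h1 := setIntegral_Iic_mul_expPrim ha x
      have h2 : Integrable fun y => A z y * f z y + B z y * g z y :=
        (hint (hA z) hAk hfc hMf).add (hint (hB z) hBk hgc hMg)
      rw [show f z x - F x = (f z x - 1) - (F x - 1) by ring, hF, ← h1, hfe x, add_sub_cancel_left,
        ← integral_sub h2.integrableOn (integrable_mul_expPrim ha ha).integrableOn]
      congr 1
      funext y
      ring
    have hge' : ∀ x, g z x = S z x + ∫ y in Set.Iic x, osc (ω z) x y *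
        (C z y * (f z y - F y) + D z y * g z y + (C z y - c y) * F y) := by
      intro x
      have h2 : Integrable fun y => C z y * f z y + D z y * g z y :=
        (hint (hC z) hCk hfc hMf).add (hint (hD z) hDk hgc hMg)
      rw [hge x, ← sub_eq_iff_eq_add', hS,
        ← integral_sub (integrable_osc_mul h2 _ x).integrableOn
          (integrable_osc_mul hcF _ x).integrableOn]
      congr 1
      funext y
      ring
    have hr0 : ∀ y, 0 ≤ r z y := fun y => by
      have := integral_nonneg (μ := volume) (f := k) hk0
      have := Real.exp_pos (∫ y, ‖a y‖)
      positivity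
    refine le_of_le_add_setIntegral_Iic (hk.const_mul 2) (fun y => mul_nonneg two_pos.le (hk0 y))
      hφc (fun y => by positivity) hφM (hrc z) hr0
      (fun y => add_le_add_left (hSb z y) _) (fun x => ?_) x
    have h1 := bound (fun _ => 1) x hAk hBk hAa (by simp)
    have h2 := bound (osc (ω z) x) x hCk hDk hCc (norm_osc _ x)
    rw [← hwe x] at h1
    have h3 := (congrArg norm (hge' x)).le.trans
      ((norm_add_le _ _).trans (add_le_add le_rfl h2))
    simp_rw [mul_assoc 2 (k _), integral_const_mul]
    simp only [hr]
    linarith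
  have hlim : Tendsto (fun z => ‖f z x - F x‖ + ‖g z x‖) l (𝓝 0) := by
    refine squeeze_zero' (Eventually.of_forall fun z => by positivity) key ?_
    simpa using (hr_lim x).add ((hkr_lim.const_mul 2).mul_const (Real.exp (2 * ∫ y, 2 * k y)))
  constructor
  · rw [tendsto_iff_norm_sub_tendsto_zero]
    exact squeeze_zero (fun _ => norm_nonneg _) (fun z => le_add_of_nonneg_right (norm_nonneg _))
      hlim
  · exact squeeze_zero_norm (fun z => le_add_of_nonneg_left (norm_nonneg _)) hlim

lemma tendsto_cocompact_of_norm_eq {ι : Type*} {l : Filter ι} {f g : ι → ℝ}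
    (hf : Tendsto f l (cocompact ℝ)) (hfg : ∀ z, ‖g z‖ = ‖f z‖) : Tendsto g l (cocompact ℝ) := by
  rw [← Metric.cobounded_eq_cocompact, ← tendsto_norm_atTop_iff_cobounded] at hf ⊢
  exact hf.congr fun z => (hfg z).symm

lemma tendsto_sub_inv_div_two_cocompact :
    Tendsto (fun z : ℝ => (z - z⁻¹) / 2) (𝓝[≠] 0) (cocompact ℝ) := by
  rw [← Metric.cobounded_eq_cocompact, ← tendsto_norm_atTop_iff_cobounded]
  have h1 : Tendsto (fun z : ℝ => ‖z⁻¹‖) (𝓝[≠] 0) atTop :=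
    tendsto_norm_cobounded_atTop.comp tendsto_inv₀_nhdsNE_zero
  have h2 : Tendsto (fun z : ℝ => -‖z‖) (𝓝[≠] 0) (𝓝 (-‖(0 : ℝ)‖)) :=
    ((continuous_norm.neg).tendsto 0).mono_left nhdsWithin_le_nhds
  refine tendsto_atTop_mono (fun z => ?_)
    ((h1.atTop_add h2).atTop_div_const (two_pos : (0 : ℝ) < 2))
  rw [norm_div, Real.norm_of_nonneg (two_pos.le : (0 : ℝ) ≤ 2)]
  have := norm_sub_norm_le z⁻¹ z
  rw [norm_sub_rev] at this
  linarith

lemma mulVec_apply_of_ne {i j : Fin 2} (hij : i ≠ j) (M : Matrix (Fin 2) (Fin 2) ℂ)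
    (w : Fin 2 → ℂ) : M.mulVec w i = M i i * w i + M i j * w j := by
  fin_cases i <;> fin_cases j <;> simp_all [Matrix.mulVec, dotProduct, Fin.sum_univ_two, add_comm]

/-- The componentwise form, for the initial vector `e_i`, of the Volterra equation on `(-∞, x]`
with coefficient matrix `P + z R` and phase `w`. -/
def IsVolterraSol (P R : ℝ → Matrix (Fin 2) (Fin 2) ℂ) (i j : Fin 2) (w z : ℝ)
    (m : ℝ → Fin 2 → ℂ) : Prop :=
  BddCont m ∧
  (∀ x, m x i = 1 + ∫ y in Set.Iic x, (P y + (z : ℂ) • R y).mulVec (m y) i) ∧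
  ∀ x, m x j = ∫ y in Set.Iic x, osc w x y * (P y + (z : ℂ) • R y).mulVec (m y) j

theorem tendsto_of_isVolterraSol {P R : ℝ → Matrix (Fin 2) (Fin 2) ℂ} {i j : Fin 2}
    (hij : i ≠ j) (hP : ∀ i j, Integrable fun y => P y i j) (hR : ∀ i j, Integrable fun y => R y i j)
    {ω : ℝ → ℝ} (hω : Tendsto ω (𝓝[≠] 0) (cocompact ℝ)) {m : ℝ → ℝ → Fin 2 → ℂ}
    (hm : ∀ z : ℝ, 0 < |z| → |z| < 1 → IsVolterraSol P R i j (ω z) z (m z)) (x : ℝ) :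
    Tendsto (fun z => m z x) (𝓝[≠] 0)
      (𝓝 (Complex.exp (∫ y in Set.Iic x, P y i i) • Pi.single i 1)) := by
  set k : ℝ → ℝ := fun y => ∑ p, ∑ q, (‖P y p q‖ + ‖R y p q‖) with hk
  have hki : Integrable k :=
    integrable_finsetSum _ fun p _ => integrable_finsetSum _ fun q _ =>
      (hP p q).norm.add (hR p q).norm
  have hle : ∀ p q y, ‖P y p q‖ + ‖R y p q‖ ≤ k y := fun p q y =>
    (Finset.single_le_sum (f := fun q => ‖P y p q‖ + ‖R y p q‖)
      (fun q _ => by positivity) (Finset.mem_univ q)).trans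
      (Finset.single_le_sum (f := fun p => ∑ q, (‖P y p q‖ + ‖R y p q‖))
        (fun p _ => Finset.sum_nonneg fun q _ => by positivity) (Finset.mem_univ p))
  have hmeas : ∀ p q (z : ℝ), AEStronglyMeasurable fun y => (P y + (z : ℂ) • R y) p q :=
    fun p q z => ((hP p q).add ((hR p q).const_mul (z : ℂ))).aestronglyMeasurable
  have hbd : ∀ p q (z : ℝ), |z| < 1 → ∀ y, ‖(P y + (z : ℂ) • R y) p q‖ ≤ k y := by
    intro p q z hz y
    refine le_trans ?_ (hle p q y)
    rw [Matrix.add_apply, Matrix.smul_apply, smul_eq_mul]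
    refine (norm_add_le _ _).trans (add_le_add le_rfl ?_)
    rw [norm_mul, Complex.norm_real]
    exact mul_le_of_le_one_left (norm_nonneg _) hz.le
  have hdiff : ∀ p q (z : ℝ) y, ‖(P y + (z : ℂ) • R y) p q - P y p q‖ ≤ |z| * k y := by
    intro p q z y
    rw [Matrix.add_apply, Matrix.smul_apply, smul_eq_mul, add_sub_cancel_left, norm_mul,
      Complex.norm_real, Real.norm_eq_abs]
    exact mul_le_mul_of_nonneg_left (by linarith [hle p q y, norm_nonneg (P y p q)]) (abs_nonneg z)
  have hδ : Tendsto (fun z : ℝ => |z|) (𝓝[≠] 0) (𝓝 0) := by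
    simpa using (continuous_abs.tendsto (0 : ℝ)).mono_left nhdsWithin_le_nhds
  have main := tendsto_volterra (l := 𝓝[≠] (0 : ℝ)) (f := fun z y => m z y i)
    (g := fun z y => m z y j) hki (hP i i) (hP j i) hδ hω (hmeas i i) (hmeas i j) (hmeas j i)
    (hmeas j j) (by
      filter_upwards [hδ.eventually (gt_mem_nhds one_pos), self_mem_nhdsWithin] with z hz hz0
      obtain ⟨⟨hc, M, hM⟩, h1, h2⟩ := hm z (abs_pos.2 hz0) hz
      refine ⟨abs_nonneg z, hbd i i z hz, hbd i j z hz, hbd j i z hz, hbd j j z hz, hdiff i i z,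
        hdiff j i z, (continuous_apply i).comp hc, (continuous_apply j).comp hc,
        ⟨M, fun x => (norm_le_pi_norm _ _).trans (hM x)⟩,
        ⟨M, fun x => (norm_le_pi_norm _ _).trans (hM x)⟩, fun x => ?_, fun x => ?_⟩
      · simpa only [mulVec_apply_of_ne hij] using h1 x
      · simpa only [mulVec_apply_of_ne hij.symm, add_comm] using h2 x) x
  rw [tendsto_pi_nhds]
  intro p
  have hp : p = i ∨ p = j := by omega
  rcases hp with rfl | rfl
  · simpa [expPrim] using main.1
  · simpa [Pi.single_eq_of_ne hij.symm] using main.2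

lemma osc_neg_neg (w x y : ℝ) : osc (-w) (-x) (-y) = osc w x y := by
  unfold osc
  congr 1
  push_cast
  ring

/-- Reflected version of `tendsto_of_isVolterraSol`, for the Volterra equation on `[x, ∞)`. -/
theorem tendsto_of_volterra_Ici {P R : ℝ → Matrix (Fin 2) (Fin 2) ℂ} {i j : Fin 2}
    (hij : i ≠ j) (hP : ∀ i j, Integrable fun y => P y i j) (hR : ∀ i j, Integrable fun y => R y i j)
    {ω : ℝ → ℝ} (hω : Tendsto ω (𝓝[≠] 0) (cocompact ℝ)) {m : ℝ → ℝ → Fin 2 → ℂ}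
    (hm : ∀ z : ℝ, 0 < |z| → |z| < 1 → BddCont (m z) ∧
      (∀ x, m z x i = 1 - ∫ y in Set.Ici x, (P y + (z : ℂ) • R y).mulVec (m z y) i) ∧
      ∀ x, m z x j = -∫ y in Set.Ici x,
        osc (ω z) x y * (P y + (z : ℂ) • R y).mulVec (m z y) j) (x : ℝ) :
    Tendsto (fun z => m z x) (𝓝[≠] 0)
      (𝓝 (Complex.exp (-∫ y in Set.Ici x, P y i i) • Pi.single i 1)) := by
  have key := tendsto_of_isVolterraSol (P := fun y => -P (-y)) (R := fun y => -R (-y)) hij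
    (fun p q => (hP p q).comp_neg.neg) (fun p q => (hR p q).comp_neg.neg)
    (ω := fun z => -ω z) (tendsto_cocompact_of_norm_eq hω fun z => norm_neg _)
    (m := fun z x => m z (-x)) (fun z hz0 hz1 => ?_) (-x)
  · simp only [neg_neg, Matrix.neg_apply] at key
    rwa [integral_neg, integral_comp_neg_Iic (-x) (fun y => P y i i), neg_neg,
      ← integral_Ici_eq_integral_Ioi] at key
  · obtain ⟨⟨hc, M, hM⟩, h1, h2⟩ := hm z hz0 hz1
    refine ⟨⟨hc.comp continuous_neg, M, fun x => hM _⟩, fun x => ?_, fun x => ?_⟩ <;> beta_reduce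
    · rw [h1, sub_eq_add_neg, ← integral_neg, integral_Ici_eq_integral_Ioi,
        ← integral_comp_neg_Iic]
      simp only [smul_neg, ← neg_add, Matrix.neg_mulVec, Pi.neg_apply]
    · rw [h2, ← integral_neg, integral_Ici_eq_integral_Ioi, ← integral_comp_neg_Iic]
      simp only [smul_neg, ← neg_add, Matrix.neg_mulVec, Pi.neg_apply, mul_neg]
      congr 1
      funext y
      rw [← osc_neg_neg (ω z), neg_neg, neg_neg]

lemma setIntegral_diag_mul_mulVec {M : ℝ → Matrix (Fin 2) (Fin 2) ℂ}
    (hM : ∀ i j, Integrable fun y => M y i j) {m : ℝ → Fin 2 → ℂ} (hm : BddCont m)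
    {s t : ℝ → ℂ} (hs : Continuous s) (ht : Continuous t) (hs1 : ∀ y, ‖s y‖ = 1)
    (ht1 : ∀ y, ‖t y‖ = 1) (S : Set ℝ) :
    (∫ y in S, (!![s y, 0; 0, t y] * M y).mulVec (m y)) 0 =
        ∫ y in S, s y * (M y).mulVec (m y) 0 ∧
      (∫ y in S, (!![s y, 0; 0, t y] * M y).mulVec (m y)) 1 =
        ∫ y in S, t y * (M y).mulVec (m y) 1 := by
  obtain ⟨hmc, C, hC⟩ := hm
  have h0 : ∀ y, (!![s y, 0; 0, t y] * M y).mulVec (m y) 0 = s y * (M y).mulVec (m y) 0 := by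
    intro y
    rw [← Matrix.mulVec_mulVec]
    simp [Matrix.mulVec, dotProduct, Fin.sum_univ_two]
  have h1 : ∀ y, (!![s y, 0; 0, t y] * M y).mulVec (m y) 1 = t y * (M y).mulVec (m y) 1 := by
    intro y
    rw [← Matrix.mulVec_mulVec]
    simp [Matrix.mulVec, dotProduct, Fin.sum_univ_two]
  have hMm : ∀ i, Integrable fun y => (M y).mulVec (m y) i := fun i => by
    simp only [Matrix.mulVec, dotProduct]
    exact integrable_finsetSum _ fun j _ => (hM i j).mul_bdd
      ((continuous_apply j).comp hmc).aestronglyMeasurable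
      (Eventually.of_forall fun y => (norm_le_pi_norm (m y) j).trans (hC y))
  have hV : ∀ i, Integrable fun y => (!![s y, 0; 0, t y] * M y).mulVec (m y) i := by
    rw [Fin.forall_fin_two]
    simp only [h0, h1]
    exact ⟨(hMm 0).bdd_mul hs.aestronglyMeasurable (Eventually.of_forall fun y => (hs1 y).le),
      (hMm 1).bdd_mul ht.aestronglyMeasurable (Eventually.of_forall fun y => (ht1 y).le)⟩
  rw [eval_integral fun i => (hV i).integrableOn, eval_integral fun i => (hV i).integrableOn]
  simp only [h0, h1, and_self]

lemma Em_eq_osc (z x y : ℝ) : Em z x y = osc (-((z - z⁻¹) / 2)) x y := by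
  unfold Em osc
  congr 1
  push_cast
  ring

lemma Em_swap_eq_osc (z x y : ℝ) : Em z y x = osc ((z - z⁻¹) / 2) x y := by
  unfold Em osc
  congr 1
  push_cast
  ring

section Coefficients

variable {u v : ℝ → ℂ}

lemma integrable_Q2 (hu : Integrable u) (hv : Integrable v)
    (huB : ∃ M : ℝ, ∀ x : ℝ, ‖u x‖ ≤ M) (i j : Fin 2) :
    Integrable fun y => Q2 u v y i j := by
  obtain ⟨Mu, hMu⟩ := huB
  have hv' : Integrable fun y => starRingEnd ℂ (v y) :=
    (LinearIsometryEquiv.integrable_comp_iff Complex.conjLIE).2 hv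
  have huv : Integrable fun y => u y * starRingEnd ℂ (v y) :=
    hv'.bdd_mul hu.aestronglyMeasurable (Eventually.of_forall hMu)
  have huuv : Integrable fun y => u y ^ 2 * starRingEnd ℂ (v y) :=
    (huv.bdd_mul hu.aestronglyMeasurable (Eventually.of_forall hMu)).congr
      (Eventually.of_forall fun y => by ring)
  fin_cases i <;> fin_cases j
  · exact huv.const_mul (I / 2)
  · exact hv'.neg.const_mul (I / 2)
  · exact (hu.add huuv).const_mul (I / 2)
  · exact huv.neg.const_mul (I / 2)

lemma integrable_norm_sq_of_bounded (hu : Integrable u) (huB : ∃ M : ℝ, ∀ x : ℝ, ‖u x‖ ≤ M) :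
    Integrable fun y => ‖u y‖ ^ 2 := by
  obtain ⟨Mu, hMu⟩ := huB
  simp_rw [pow_two]
  exact hu.norm.bdd_mul (c := Mu) hu.norm.aestronglyMeasurable
    (Eventually.of_forall fun y => by simpa using hMu y)

lemma integrable_Q1 (hu : Integrable u) (hv : Integrable v)
    (huB : ∃ M : ℝ, ∀ x : ℝ, ‖u x‖ ≤ M) (hvB : ∃ M : ℝ, ∀ x : ℝ, ‖v x‖ ≤ M)
    (hu' : Integrable (deriv u)) (i j : Fin 2) :
    Integrable fun y => Q1 u v y i j := by
  have hnv : Integrable fun y => (‖v y‖ : ℂ) ^ 2 := by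
    simpa using (integrable_norm_sq_of_bounded hv hvB).ofReal (𝕜 := ℂ)
  have hnu : Integrable fun y => (‖u y‖ : ℂ) ^ 2 := by
    simpa using (integrable_norm_sq_of_bounded hu huB).ofReal (𝕜 := ℂ)
  obtain ⟨Mu, hMu⟩ := huB
  have hcu : Integrable fun y => starRingEnd ℂ (u y) :=
    (LinearIsometryEquiv.integrable_comp_iff Complex.conjLIE).2 hu
  have huv : Integrable fun y => I / 2 * u y * (‖v y‖ : ℂ) ^ 2 :=
    ((hnv.bdd_mul hu.aestronglyMeasurable (Eventually.of_forall hMu)).const_mul (I / 2)).congr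
      (Eventually.of_forall fun y => by ring)
  fin_cases i <;> fin_cases j
  · exact (hnu.add hnv).const_mul (-(I / 4))
  · exact hcu.const_mul (I / 2)
  · exact (hu'.sub huv).sub (hv.const_mul (I / 2))
  · exact (hnu.add hnv).const_mul (I / 4)

lemma setIntegral_Q1_zero_zero (u v : ℝ → ℂ) (S : Set ℝ) :
    ∫ y in S, Q1 u v y 0 0 = -(I / 4) * ((∫ y in S, (‖u y‖ ^ 2 + ‖v y‖ ^ 2) : ℝ) : ℂ) := by
  rw [← integral_complex_ofReal, ← integral_const_mul]
  simp [Q1]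

lemma setIntegral_Q1_one_one (u v : ℝ → ℂ) (S : Set ℝ) :
    ∫ y in S, Q1 u v y 1 1 = I / 4 * ((∫ y in S, (‖u y‖ ^ 2 + ‖v y‖ ^ 2) : ℝ) : ℂ) := by
  rw [← integral_complex_ofReal, ← integral_const_mul]
  simp [Q1]

lemma e1_eq_single : e1 = Pi.single 0 1 := by
  ext i; fin_cases i <;> simp [e1]

lemma e2_eq_single : e2 = Pi.single 1 1 := by
  ext i; fin_cases i <;> simp [e2]

end Coefficients

/-- Limits of the transformed Jost functions as z → 0 (z real, z ≠ 0):
m₊^∞ = e^{(i/4)∫_x^∞}, m₋^∞ = e^{−(i/4)∫_{−∞}^x}, and the inverses for n. -/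
theorem jost_limits_z_to_zero (u v : ℝ → ℂ)
    (hu1 : Integrable u) (hv1 : Integrable v)
    (huB : ∃ M : ℝ, ∀ x : ℝ, ‖u x‖ ≤ M) (hvB : ∃ M : ℝ, ∀ x : ℝ, ‖v x‖ ≤ M)
    (hud : Differentiable ℝ u) (hu'1 : Integrable (deriv u))
    (mp mm np nm : ℝ → ℝ → Fin 2 → ℂ)
    (hsol : ∀ z : ℝ, 0 < |z| → |z| < 1 → IsSol u v z (mp z) (mm z) (np z) (nm z)) :
    ∀ x : ℝ,
      Tendsto (fun z : ℝ => mp z x) (𝓝[≠] 0)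
        (𝓝 (Complex.exp (I / 4 * (Jp u v x : ℂ)) • e1)) ∧
      Tendsto (fun z : ℝ => mm z x) (𝓝[≠] 0)
        (𝓝 (Complex.exp (-(I / 4) * (Jm u v x : ℂ)) • e1)) ∧
      Tendsto (fun z : ℝ => np z x) (𝓝[≠] 0)
        (𝓝 (Complex.exp (-(I / 4) * (Jp u v x : ℂ)) • e2)) ∧
      Tendsto (fun z : ℝ => nm z x) (𝓝[≠] 0)
        (𝓝 (Complex.exp (I / 4 * (Jm u v x : ℂ)) • e2)) := by
  have hQ1 := integrable_Q1 hu1 hv1 huB hvB hu'1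
  have hQ2 := integrable_Q2 hu1 hv1 huB
  have hM : ∀ (z : ℝ) (i j : Fin 2), Integrable fun y => (Q1 u v y + (z : ℂ) • Q2 u v y) i j :=
    fun z i j => (hQ1 i j).add ((hQ2 i j).const_mul (z : ℂ))
  have hω := tendsto_sub_inv_div_two_cocompact
  have hω' := tendsto_cocompact_of_norm_eq hω fun z => norm_neg ((z - z⁻¹) / 2)
  intro x
  refine ⟨?_, ?_, ?_, ?_⟩
  · have key := tendsto_of_volterra_Ici (i := 0) (j := 1) (by decide) hQ1 hQ2 hω' (m := mp)
      (fun z hz0 hz1 => ?_) x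
    · simpa only [setIntegral_Q1_zero_zero, Jp, neg_mul, neg_neg, e1_eq_single] using key
    · obtain ⟨hb, -, -, -, h, -, -, -⟩ := hsol z hz0 hz1
      simp only [Em_eq_osc] at h
      have hi := fun x => setIntegral_diag_mul_mulVec (hM z) hb (s := fun _ => 1)
        (t := osc (-((z - z⁻¹) / 2)) x) continuous_const (continuous_osc _ x) (by simp)
        (norm_osc _ x) (Set.Ici x)
      refine ⟨hb, fun x => ?_, fun x => ?_⟩
      · have hx := congrFun (h x) 0
        rw [Pi.sub_apply, (hi x).1] at hx
        simpa [e1] using hx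
      · have hx := congrFun (h x) 1
        rw [Pi.sub_apply, (hi x).2] at hx
        simpa [e1] using hx
  · have key := tendsto_of_isVolterraSol (i := 0) (j := 1) (by decide) hQ1 hQ2 hω' (m := mm)
      (fun z hz0 hz1 => ?_) x
    · simpa only [setIntegral_Q1_zero_zero, Jm, neg_mul, neg_neg, e1_eq_single] using key
    · obtain ⟨-, hb, -, -, -, h, -, -⟩ := hsol z hz0 hz1
      simp only [Em_eq_osc] at h
      have hi := fun x => setIntegral_diag_mul_mulVec (hM z) hb (s := fun _ => 1)
        (t := osc (-((z - z⁻¹) / 2)) x) continuous_const (continuous_osc _ x) (by simp)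
        (norm_osc _ x) (Set.Iic x)
      refine ⟨hb, fun x => ?_, fun x => ?_⟩
      · have hx := congrFun (h x) 0
        rw [Pi.add_apply, (hi x).1] at hx
        simpa [e1] using hx
      · have hx := congrFun (h x) 1
        rw [Pi.add_apply, (hi x).2] at hx
        simpa [e1] using hx
  · have key := tendsto_of_volterra_Ici (i := 1) (j := 0) (by decide) hQ1 hQ2 hω (m := np)
      (fun z hz0 hz1 => ?_) x
    · simpa only [setIntegral_Q1_one_one, Jp, neg_mul, neg_neg, e2_eq_single] using key
    · obtain ⟨-, -, hb, -, -, -, h, -⟩ := hsol z hz0 hz1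
      simp only [Em_swap_eq_osc] at h
      have hi := fun x => setIntegral_diag_mul_mulVec (hM z) hb (s := osc ((z - z⁻¹) / 2) x)
        (t := fun _ => 1) (continuous_osc _ x) continuous_const (norm_osc _ x) (by simp) (Set.Ici x)
      refine ⟨hb, fun x => ?_, fun x => ?_⟩
      · have hx := congrFun (h x) 1
        rw [Pi.sub_apply, (hi x).2] at hx
        simpa [e2] using hx
      · have hx := congrFun (h x) 0
        rw [Pi.sub_apply, (hi x).1] at hx
        simpa [e2] using hx
  · have key := tendsto_of_isVolterraSol (i := 1) (j := 0) (by decide) hQ1 hQ2 hω (m := nm)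
      (fun z hz0 hz1 => ?_) x
    · simpa only [setIntegral_Q1_one_one, Jm, neg_mul, neg_neg, e2_eq_single] using key
    · obtain ⟨-, -, -, hb, -, -, -, h⟩ := hsol z hz0 hz1
      simp only [Em_swap_eq_osc] at h
      have hi := fun x => setIntegral_diag_mul_mulVec (hM z) hb (s := osc ((z - z⁻¹) / 2) x)
        (t := fun _ => 1) (continuous_osc _ x) continuous_const (norm_osc _ x) (by simp) (Set.Iic x)
      refine ⟨hb, fun x => ?_, fun x => ?_⟩
      · have hx := congrFun (h x) 1
        rw [Pi.add_apply, (hi x).2] at hx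
        simpa [e2] using hx
      · have hx := congrFun (h x) 0
        rw [Pi.add_apply, (hi x).1] at hx
        simpa [e2] using hx
end

section
/- Let f : ℝ → ℂ be continuously differentiable such that f ∈ L²(ℝ) and the function x ↦ x·f'(x) belongs to L²(ℝ). Then for every z ∈ ℝ, |z|·|f(z)|² ≤ ‖f‖²_{L²(ℝ)} + 2·‖f‖_{L²(ℝ)}·‖x·f'(x)‖_{L²(ℝ)}. In particular the function z ↦ z·f(z)² is bounded on ℝ. -/
open MeasureTheory

/-- The Cauchy–Schwarz inequality for the norms of two square-integrable functions. -/
theorem integral_norm_mul_norm_le_sqrt_mul_sqrt {α E : Type*} [MeasurableSpace α]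
    {μ : Measure α} [NormedAddCommGroup E] {f g : α → E} (hf : MemLp f 2 μ) (hg : MemLp g 2 μ) :
    ∫ x, ‖f x‖ * ‖g x‖ ∂μ ≤
      Real.sqrt (∫ x, ‖f x‖ ^ 2 ∂μ) * Real.sqrt (∫ x, ‖g x‖ ^ 2 ∂μ) := by
  have h := integral_mul_norm_le_Lp_mul_Lq (μ := μ) (f := f) (g := g)
    Real.HolderConjugate.two_two (by simpa using hf) (by simpa using hg)
  simpa only [Real.rpow_two, ← Real.sqrt_eq_rpow] using h

/-- The fundamental theorem of calculus for `z ↦ z * f z ^ 2`. -/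
theorem integral_sq_add_two_mul_mul_deriv {f : ℝ → ℂ} (hf : ContDiff ℝ 1 f) (z : ℝ) :
    ∫ x in (0 : ℝ)..z, (f x ^ 2 + 2 * (f x * ((x : ℂ) * deriv f x))) = (z : ℂ) * f z ^ 2 := by
  have hc : Continuous f := hf.continuous
  have hc' : Continuous (deriv f) := hf.continuous_deriv le_rfl
  have hd : ∀ x : ℝ, HasDerivAt (fun x : ℝ => (x : ℂ) * f x ^ 2)
      (f x ^ 2 + 2 * (f x * ((x : ℂ) * deriv f x))) x := fun x => by
    have hfx : HasDerivAt f (deriv f x) x :=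
      (hf.differentiable one_ne_zero x).hasDerivAt
    refine ((hasDerivAt_id x).ofReal_comp.mul (hfx.pow 2)).congr_deriv ?_
    simp
    ring
  rw [intervalIntegral.integral_eq_sub_of_hasDerivAt (fun x _ => hd x)
    (Continuous.intervalIntegrable (by fun_prop) _ _)]
  simp

/-- If f ∈ L²(ℝ) is C¹ and x·f'(x) ∈ L²(ℝ), then |z||f(z)|² ≤ ‖f‖² + 2‖f‖·‖xf'‖,
so z·f(z)² is bounded on ℝ. -/
theorem pointwise_weighted_bound_of_weighted_deriv (f : ℝ → ℂ)
    (hf : ContDiff ℝ 1 f)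
    (hf2 : Integrable (fun x : ℝ => ‖f x‖ ^ 2))
    (hxf' : Integrable (fun x : ℝ => ‖(x : ℂ) * deriv f x‖ ^ 2)) :
    (∀ z : ℝ, |z| * ‖f z‖ ^ 2 ≤ (∫ x : ℝ, ‖f x‖ ^ 2)
        + 2 * Real.sqrt (∫ x : ℝ, ‖f x‖ ^ 2)
            * Real.sqrt (∫ x : ℝ, ‖(x : ℂ) * deriv f x‖ ^ 2)) ∧
    (∃ M : ℝ, ∀ z : ℝ, ‖(z : ℂ) * (f z) ^ 2‖ ≤ M) := by
  have hc : Continuous f := hf.continuous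
  have hc' : Continuous (deriv f) := hf.continuous_deriv le_rfl
  have hg : Continuous fun x : ℝ => (x : ℂ) * deriv f x := by fun_prop
  have hfL : MemLp f 2 := (memLp_two_iff_integrable_sq_norm hc.aestronglyMeasurable).2 hf2
  have hgL : MemLp (fun x : ℝ => (x : ℂ) * deriv f x) 2 :=
    (memLp_two_iff_integrable_sq_norm hg.aestronglyMeasurable).2 hxf'
  have hfg : Integrable fun x : ℝ => 2 * (‖f x‖ * ‖(x : ℂ) * deriv f x‖) :=
    (hfL.norm.integrable_mul hgL.norm).const_mul 2
  have key : ∀ z : ℝ, ‖(z : ℂ) * f z ^ 2‖ ≤ (∫ x : ℝ, ‖f x‖ ^ 2)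
      + 2 * Real.sqrt (∫ x : ℝ, ‖f x‖ ^ 2)
          * Real.sqrt (∫ x : ℝ, ‖(x : ℂ) * deriv f x‖ ^ 2) := fun z => by
    have hle : ∀ x : ℝ, ‖f x ^ 2 + 2 * (f x * ((x : ℂ) * deriv f x))‖ ≤
        ‖f x‖ ^ 2 + 2 * (‖f x‖ * ‖(x : ℂ) * deriv f x‖) := fun x =>
      (norm_add_le _ _).trans_eq (by simp only [norm_pow, norm_mul, Complex.norm_ofNat])
    have hint : Integrable fun x : ℝ => f x ^ 2 + 2 * (f x * ((x : ℂ) * deriv f x)) :=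
      (hf2.add hfg).mono' (by fun_prop) (.of_forall hle)
    calc ‖(z : ℂ) * f z ^ 2‖
        = ‖∫ x in (0 : ℝ)..z, (f x ^ 2 + 2 * (f x * ((x : ℂ) * deriv f x)))‖ := by
          rw [integral_sq_add_two_mul_mul_deriv hf]
      _ ≤ ∫ x in Set.uIoc 0 z, ‖f x ^ 2 + 2 * (f x * ((x : ℂ) * deriv f x))‖ :=
          intervalIntegral.norm_integral_le_integral_norm_uIoc
      _ ≤ ∫ x : ℝ, ‖f x ^ 2 + 2 * (f x * ((x : ℂ) * deriv f x))‖ :=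
          setIntegral_le_integral hint.norm (.of_forall fun _ => norm_nonneg _)
      _ ≤ ∫ x : ℝ, (‖f x‖ ^ 2 + 2 * (‖f x‖ * ‖(x : ℂ) * deriv f x‖)) :=
          integral_mono hint.norm (hf2.add hfg) hle
      _ = (∫ x : ℝ, ‖f x‖ ^ 2) + 2 * ∫ x : ℝ, ‖f x‖ * ‖(x : ℂ) * deriv f x‖ := by
          rw [integral_add hf2 hfg, integral_const_mul]
      _ ≤ _ := by
          rw [mul_assoc]
          gcongr
          exact integral_norm_mul_norm_le_sqrt_mul_sqrt hfL hgL
  refine ⟨fun z => ?_, _, key⟩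
  simpa only [norm_mul, norm_pow, Complex.norm_real, Real.norm_eq_abs] using key z
end
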